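/- arXiv:2007.10432 — 9 statements merged into one kernel-verified Lean document; each statement's English description precedes it below -/
import Mathlib

section
/- Under one-to-one targeting, for any targeted treatment t ∈ 𝒯* (with unique targeting instrument z̄(t)): if the observation's counterfactual treatment at the targeting instrument satisfies T(z̄(t)) = 0, then T(z) ≠ t for every instrument value z ∈ 𝒵. -/
open Set

noncomputable section

variable {𝒯 𝒵 : Type*}

/-- Relative mean value `Δ_z(t) = U_z(t) - U_z(t₀)` of treatment `t` under instrument `z`,
with reference treatment `t0`. -/
def Δrel (U : 𝒵 → 𝒯 → ℝ) (t0 : 𝒯) (z : 𝒵) (t : 𝒯) : ℝ := U z t - U z t0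

/-- `Z̄(t)`: the set of instruments maximizing `z ↦ Δ_z(t)`. -/
def Zbar (U : 𝒵 → 𝒯 → ℝ) (t0 : 𝒯) (t : 𝒯) : Set 𝒵 :=
  {z | ∀ z' : 𝒵, Δrel U t0 z' t ≤ Δrel U t0 z t}

/-- `𝒯*`: the set of targeted treatments. -/
def Tstar (U : 𝒵 → 𝒯 → ℝ) (t0 : 𝒯) : Set 𝒯 := {t | Zbar U t0 t ≠ univ}

/-- `𝒵*`: the set of targeting instruments. -/
def Zstar (U : 𝒵 → 𝒯 → ℝ) (t0 : 𝒯) : Set 𝒵 := ⋃ t ∈ Tstar U t0, Zbar U t0 t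

/-- `T̄(z)`: the set of targeted treatments targeted by `z`. -/
def Tbar (U : 𝒵 → 𝒯 → ℝ) (t0 : 𝒯) (z : 𝒵) : Set 𝒯 :=
  {t | t ∈ Tstar U t0 ∧ z ∈ Zbar U t0 t}

/-- Proposition 1 (unfiltered response groups under one-to-one targeting):
if `t ∈ 𝒯*` and `T(z̄(t)) = 0` (the reference treatment), then `T(z) ≠ t` for all `z`. -/
theorem statement0 [Fintype 𝒯] [Fintype 𝒵]
    (U : 𝒵 → 𝒯 → ℝ) (u : 𝒯 → ℝ) (t0 : 𝒯) (T : 𝒵 → 𝒯)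
    (hARUM : ∀ z t, U z t + u t ≤ U z (T z) + u (T z))
    (zbar : 𝒯 → 𝒵) (tbar : 𝒵 → 𝒯)
    (h11Z : ∀ t ∈ Tstar U t0, Zbar U t0 t = {zbar t})
    (h11T : ∀ z ∈ Zstar U t0, Tbar U t0 z = {tbar z})
    (t : 𝒯) (ht : t ∈ Tstar U t0)
    (h0 : T (zbar t) = t0) :
    ∀ z : 𝒵, T z ≠ t := by
  rintro z hz
  have hmax : zbar t ∈ Zbar U t0 t := by rw [h11Z t ht]; rfl
  have hle : Δrel U t0 (zbar t) t ≤ Δrel U t0 z t := by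
    have h1 := hARUM (zbar t) t
    have h2 := hARUM z t0
    rw [h0] at h1
    rw [hz] at h2
    unfold Δrel
    linarith
  have hmem : z ∈ Zbar U t0 t := fun z' => (hmax z').trans hle
  rw [h11Z t ht, mem_singleton_iff] at hmem
  have htt0 : t = t0 := by rw [← hz, hmem, h0]
  exact ht (eq_univ_of_forall fun z z' => by simp [Δrel, htt0])
end
end

section
/- Under strict targeting with 𝒵₀ := 𝒵 ∖ 𝒵* nonempty, for every observation: (i) for every z ∈ 𝒵*, the selected treatment T(z) lies in T*(z) ∪ τ*, where T*(z) is the set of top targeted treatments at z and τ* is the set of top alternative treatments; (ii) for every z ∈ 𝒵₀, T(z) ∈ τ*. -/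
open Set

noncomputable section

variable {𝒯 𝒵 : Type*}

/-- `T*(z)`: the set of top targeted treatments at `z`
(the maximizers of `t ↦ Δ̄_t + u_t` over `T̄(z)`). -/
def TopTargeted (U : 𝒵 → 𝒯 → ℝ) (t0 : 𝒯) (Δbar : 𝒯 → ℝ) (u : 𝒯 → ℝ) (z : 𝒵) : Set 𝒯 :=
  {t | t ∈ Tbar U t0 z ∧ ∀ t' ∈ Tbar U t0 z, Δbar t' + u t' ≤ Δbar t + u t}

/-- `τ*`: the set of top alternative treatments
(the maximizers of `t ↦ Δ̲_t + u_t` over `𝒯`). -/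
def TopAlt (Δlow : 𝒯 → ℝ) (u : 𝒯 → ℝ) : Set 𝒯 :=
  {t | ∀ t' : 𝒯, Δlow t' + u t' ≤ Δlow t + u t}

theorem Δrel_eq_low {U : 𝒵 → 𝒯 → ℝ} {t0 : 𝒯} {Δbar Δlow : 𝒯 → ℝ}
    (hΔbar : ∀ t : 𝒯, ∀ z ∈ Zbar U t0 t, Δrel U t0 z t = Δbar t)
    (hstrict : ∀ t ∈ Tstar U t0, ∀ z ∉ Zbar U t0 t, Δrel U t0 z t = Δlow t)
    (hΔlow : ∀ t ∉ Tstar U t0, Δlow t = Δbar t)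
    {z : 𝒵} {t : 𝒯} (h : t ∉ Tbar U t0 z) : Δrel U t0 z t = Δlow t := by
  by_cases ht : t ∈ Tstar U t0
  · exact hstrict t ht z fun hz => h ⟨ht, hz⟩
  · have hz : z ∈ Zbar U t0 t := by
      rw [show Zbar U t0 t = univ from not_not.mp ht]
      exact mem_univ z
    rw [hΔlow t ht, hΔbar t z hz]

theorem low_le_Δrel {U : 𝒵 → 𝒯 → ℝ} {t0 : 𝒯} {Δbar Δlow : 𝒯 → ℝ}
    (hΔbar : ∀ t : 𝒯, ∀ z ∈ Zbar U t0 t, Δrel U t0 z t = Δbar t)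
    (hstrict : ∀ t ∈ Tstar U t0, ∀ z ∉ Zbar U t0 t, Δrel U t0 z t = Δlow t)
    (hΔlow : ∀ t ∉ Tstar U t0, Δlow t = Δbar t)
    (z : 𝒵) (t : 𝒯) : Δlow t ≤ Δrel U t0 z t := by
  by_cases h : t ∈ Tbar U t0 z
  · obtain ⟨z', hz'⟩ := (ne_univ_iff_exists_notMem _).mp h.1
    rw [← hstrict t h.1 z' hz']
    exact h.2 z'
  · exact (Δrel_eq_low hΔbar hstrict hΔlow h).ge

/-- Proposition 2 (unfiltered response groups under strict targeting):
(i) for `z ∈ 𝒵*`, `T(z) ∈ T*(z) ∪ τ*`; (ii) for `z ∈ 𝒵₀ = 𝒵 ∖ 𝒵*`, `T(z) ∈ τ*`. -/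
theorem statement2 [Fintype 𝒯] [Fintype 𝒵]
    (U : 𝒵 → 𝒯 → ℝ) (u : 𝒯 → ℝ) (t0 : 𝒯) (T : 𝒵 → 𝒯)
    (hARUM : ∀ z t, U z t + u t ≤ U z (T z) + u (T z))
    (Δbar Δlow : 𝒯 → ℝ)
    (hΔbar : ∀ t : 𝒯, ∀ z ∈ Zbar U t0 t, Δrel U t0 z t = Δbar t)
    (hstrict : ∀ t ∈ Tstar U t0, ∀ z ∉ Zbar U t0 t, Δrel U t0 z t = Δlow t)
    (hΔlow : ∀ t ∉ Tstar U t0, Δlow t = Δbar t)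
    (hZ0 : (univ \ Zstar U t0).Nonempty) :
    (∀ z ∈ Zstar U t0, T z ∈ TopTargeted U t0 Δbar u z ∪ TopAlt Δlow u)
    ∧ (∀ z ∈ univ \ Zstar U t0, T z ∈ TopAlt Δlow u) := by
  have hopt : ∀ z t, Δrel U t0 z t + u t ≤ Δrel U t0 z (T z) + u (T z) := fun z t => by
    have := hARUM z t
    unfold Δrel
    linarith
  have halt : ∀ z, T z ∉ Tbar U t0 z → T z ∈ TopAlt Δlow u := fun z hz t => by
    have := hopt z t
    rw [Δrel_eq_low hΔbar hstrict hΔlow hz] at this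
    linarith [low_le_Δrel hΔbar hstrict hΔlow z t]
  refine ⟨fun z _ => ?_, fun z hz => halt z fun h => hz.2 (mem_biUnion h.1 h.2)⟩
  by_cases h : T z ∈ Tbar U t0 z
  · refine Or.inl ⟨h, fun t ht => ?_⟩
    rw [← hΔbar t z ht.2, ← hΔbar (T z) z h.2]
    exact hopt z t
  · exact Or.inr (halt z h)
end
end

section
/- Under strict targeting with 𝒵₀ := 𝒵 ∖ 𝒵* nonempty, suppose the maximizer sets τ* and T*(z) (for each z ∈ 𝒵*) are singletons, and T(z) is the unique maximizer of t ↦ U_z(t) + u_t for each z. Let τ denote the unique element of τ* and let A := {z ∈ 𝒵* : T(z) = T*(z)}. Then the observation belongs to the class c(A, τ): (a) T(z) = T*(z) for all z ∈ A; (b) T(z) = τ for all z ∈ 𝒵 ∖ A; and (c) if τ ∈ 𝒯* then Z̄(τ) ⊆ A. -/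
open Set

noncomputable section

variable {𝒯 𝒵 : Type*}

/-- Proposition 3 (unfiltered classes under strict targeting): with `τ` the unique top
alternative treatment and `A := {z ∈ 𝒵* : T(z) = T*(z)}`, the observation belongs to the
class `c(A, τ)`: (a) `T(z) = T*(z)` on `A`; (b) `T(z) = τ` off `A`; (c) if `τ ∈ 𝒯*`
then `Z̄(τ) ⊆ A`. -/
theorem statement3 [Fintype 𝒯] [Fintype 𝒵]
    (U : 𝒵 → 𝒯 → ℝ) (u : 𝒯 → ℝ) (t0 : 𝒯) (T : 𝒵 → 𝒯)
    (hARUM : ∀ z t, t ≠ T z → U z t + u t < U z (T z) + u (T z))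
    (Δbar Δlow : 𝒯 → ℝ)
    (hΔbar : ∀ t : 𝒯, ∀ z ∈ Zbar U t0 t, Δrel U t0 z t = Δbar t)
    (hstrict : ∀ t ∈ Tstar U t0, ∀ z ∉ Zbar U t0 t, Δrel U t0 z t = Δlow t)
    (hΔlow : ∀ t ∉ Tstar U t0, Δlow t = Δbar t)
    (hZ0 : (univ \ Zstar U t0).Nonempty)
    (τ : 𝒯) (hτ : TopAlt Δlow u = {τ})
    (Ts : 𝒵 → 𝒯) (hTs : ∀ z ∈ Zstar U t0, TopTargeted U t0 Δbar u z = {Ts z}) :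
    (∀ z ∈ {z | z ∈ Zstar U t0 ∧ T z = Ts z}, T z = Ts z)
    ∧ (∀ z ∉ {z | z ∈ Zstar U t0 ∧ T z = Ts z}, T z = τ)
    ∧ (τ ∈ Tstar U t0 → Zbar U t0 τ ⊆ {z | z ∈ Zstar U t0 ∧ T z = Ts z}) := by
  have low_le : ∀ z t, Δlow t ≤ Δrel U t0 z t := by
    intro z t
    by_cases ht : t ∈ Tstar U t0
    · by_cases hz : z ∈ Zbar U t0 t
      · obtain ⟨z', hz'⟩ := (ne_univ_iff_exists_notMem _).1 ht
        rw [← hstrict t ht z' hz']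
        exact hz z'
      · exact (hstrict t ht z hz).ge
    · have hz : z ∈ Zbar U t0 t := by
        rw [not_not.1 ht]
        exact mem_univ z
      rw [hΔlow t ht, hΔbar t z hz]
  have rel_eq_low : ∀ z t, t ∉ Tbar U t0 z → Δrel U t0 z t = Δlow t := by
    intro z t h
    by_cases ht : t ∈ Tstar U t0
    · exact hstrict t ht z fun hz => h ⟨ht, hz⟩
    · have hz : z ∈ Zbar U t0 t := by
        rw [not_not.1 ht]
        exact mem_univ z
      rw [hΔlow t ht, hΔbar t z hz]
  have rel_le : ∀ z t, Δrel U t0 z t + u t ≤ Δrel U t0 z (T z) + u (T z) := by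
    intro z t
    by_cases h : t = T z
    · rw [h]
    · have := hARUM z t h
      unfold Δrel
      linarith
  have mem_Zstar : ∀ z t, t ∈ Tbar U t0 z → z ∈ Zstar U t0 :=
    fun z t h => mem_biUnion h.1 h.2
  have eq_top : ∀ z, T z ∈ Tbar U t0 z → T z = Ts z := by
    intro z h
    have hmem : T z ∈ TopTargeted U t0 Δbar u z := by
      refine ⟨h, fun t' ht' => ?_⟩
      rw [← hΔbar t' z ht'.2, ← hΔbar (T z) z h.2]
      exact rel_le z t'
    rwa [hTs z (mem_Zstar z _ h)] at hmem
  have eq_alt : ∀ z, T z ∉ Tbar U t0 z → T z = τ := by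
    intro z h
    have hmem : T z ∈ TopAlt Δlow u := by
      intro t'
      have h1 := rel_le z t'
      have h2 := low_le z t'
      rw [rel_eq_low z _ h] at h1
      linarith
    rwa [hτ] at hmem
  refine ⟨fun z hz => hz.2, fun z hz => ?_, fun hτT z hz => ?_⟩
  · exact eq_alt z fun h => hz ⟨mem_Zstar z _ h, eq_top z h⟩
  · have hτz : τ ∈ Tbar U t0 z := ⟨hτT, hz⟩
    refine ⟨mem_Zstar z τ hτz, eq_top z ?_⟩
    by_contra h
    exact h (eq_alt z h ▸ hτz)
end
end

section
/- In the 2×T ARUM with strict one-to-one targeting, the response-group probabilities are identified: P(A_1) = P(1|0); P(A_t) = P(t|1) for every t ≠ 1; and P(C_{t1}) = P(t|0) − P(t|1) for every t ≠ 1. In particular the model has the testable implications P(t|0) ≥ P(t|1) for every t ≠ 1. -/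
open MeasureTheory ProbabilityTheory

noncomputable section

variable {Ω : Type*} [MeasurableSpace Ω]

/-- Probability of an event, as a real number. -/
def prr (P : Measure Ω) (A : Set Ω) : ℝ := (P A).toReal

/-- Conditional expectation `E[X | C]` of `X` given the event `C`. -/
def cexp (P : Measure Ω) (X : Ω → ℝ) (C : Set Ω) : ℝ :=
  (∫ ω in C, X ω ∂P) / prr P C

/-- Conditional probability `P(D = d | Z = z)` (generalized propensity score). -/
def pscore {𝒟 𝒵 : Type*} (P : Measure Ω) (D : Ω → 𝒟) (Z : Ω → 𝒵) (d : 𝒟) (z : 𝒵) : ℝ :=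
  prr P ({ω | D ω = d} ∩ {ω | Z ω = z}) / prr P {ω | Z ω = z}

/-- Conditional average outcome `Ē_z(d) = E[Y·1(D = d) | Z = z]`. -/
def ebar {𝒟 𝒵 : Type*} (P : Measure Ω) (D : Ω → 𝒟) (Z : Ω → 𝒵) (Yobs : Ω → ℝ)
    (z : 𝒵) (d : 𝒟) : ℝ :=
  (∫ ω in {ω | D ω = d} ∩ {ω | Z ω = z}, Yobs ω ∂P) / prr P {ω | Z ω = z}

/-- Conditional mean outcome `E[Y | Z = z]`. -/
def ecz {𝒵 : Type*} (P : Measure Ω) (Z : Ω → 𝒵) (Yobs : Ω → ℝ) (z : 𝒵) : ℝ :=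
  (∫ ω in {ω | Z ω = z}, Yobs ω ∂P) / prr P {ω | Z ω = z}

/-- If the instrument is independent of the counterfactual treatment `T z`, the propensity score at
`z` is the law of `T z`. -/
lemma pscore_eq_prr {𝒟 𝒵 : Type*} [MeasurableSpace 𝒟] [MeasurableSingletonClass 𝒟]
    [MeasurableSpace 𝒵] [MeasurableSingletonClass 𝒵] {P : Measure Ω} [IsFiniteMeasure P]
    {T : 𝒵 → Ω → 𝒟} {Z : Ω → 𝒵} {z : 𝒵} (hZ : 0 < P {ω | Z ω = z})
    (hindep : IndepFun Z (T z) P) (d : 𝒟) :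
    pscore P (fun ω => T (Z ω) ω) Z d z = prr P {ω | T z ω = d} := by
  have hset : {ω | T (Z ω) ω = d} ∩ {ω | Z ω = z} = Z ⁻¹' {z} ∩ T z ⁻¹' {d} := by
    ext ω
    simp only [Set.mem_inter_iff, Set.mem_ofPred_eq, Set.mem_preimage, Set.mem_singleton_iff]
    constructor
    · rintro ⟨h, rfl⟩
      exact ⟨rfl, h⟩
    · rintro ⟨rfl, h⟩
      exact ⟨h, rfl⟩
  have hmul := hindep.measure_inter_preimage_eq_mul {z} {d}
    (measurableSet_singleton z) (measurableSet_singleton d)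
  have hne : (P {ω | Z ω = z}).toReal ≠ 0 :=
    (ENNReal.toReal_pos hZ.ne' (measure_ne_top P _)).ne'
  rw [pscore, hset, prr, hmul, ENNReal.toReal_mul]
  exact mul_div_cancel_left₀ _ hne

/-- Revealed preference: if only alternative `a` becomes more attractive when the utilities change
from `U₀` to `U₁`, then an agent who changes choice moves to `a`. -/
lemma eq_or_eq_of_unique_maximizers {ι : Type*} {U₀ U₁ u : ι → ℝ} {o a s r : ι}
    (hs : ∀ t, t ≠ s → U₀ t + u t < U₀ s + u s) (hr : ∀ t, t ≠ r → U₁ t + u t < U₁ r + u r)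
    (ha : U₀ a - U₀ o < U₁ a - U₁ o) (h : ∀ t, t ≠ a → U₁ t - U₁ o = U₀ t - U₀ o) :
    r = a ∨ r = s := by
  by_contra! hne
  obtain ⟨hra, hrs⟩ := hne
  have h₀ := hs r hrs
  have h₁ := hr s hrs.symm
  have hr' := h r hra
  rcases eq_or_ne s a with rfl | hsa
  · linarith
  · linarith [h s hsa]

/-- Proposition (response-group probabilities in the 2×T model under strict, one-to-one
targeting): `P(A₁) = P(1|0)`, `P(A_t) = P(t|1)` and `P(C_{t1}) = P(t|0) − P(t|1)` for
`t ≠ 1`, with the testable implications `P(t|0) ≥ P(t|1)` for `t ≠ 1`. -/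
theorem statement7
    (P : Measure Ω) [IsProbabilityMeasure P] (n : ℕ)
    (T : Fin 2 → Ω → Fin (n + 2)) (Z : Ω → Fin 2)
    (U : Fin 2 → Fin (n + 2) → ℝ) (u : Fin (n + 2) → Ω → ℝ)
    (hTmeas : ∀ z, Measurable (T z)) (hZmeas : Measurable Z)
    (humeas : ∀ t, Measurable (u t))
    (hZpos : ∀ z, 0 < P {ω | Z ω = z})
    (hindep : IndepFun Z (fun ω => ((fun z => T z ω), (fun t => u t ω))) P)
    (hmax : ∀ᵐ ω ∂P, ∀ z t, t ≠ T z ω →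
      U z t + u t ω < U z (T z ω) + u (T z ω) ω)
    (hΔ1 : U 0 1 - U 0 0 < U 1 1 - U 1 0)
    (hΔt : ∀ t : Fin (n + 2), t ≠ 1 → U 1 t - U 1 0 = U 0 t - U 0 0) :
    prr P {ω | T 0 ω = 1 ∧ T 1 ω = 1} = pscore P (fun ω => T (Z ω) ω) Z 1 0
    ∧ (∀ t : Fin (n + 2), t ≠ 1 →
        prr P {ω | T 0 ω = t ∧ T 1 ω = t} = pscore P (fun ω => T (Z ω) ω) Z t 1)
    ∧ (∀ t : Fin (n + 2), t ≠ 1 →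
        prr P {ω | T 0 ω = t ∧ T 1 ω = 1}
          = pscore P (fun ω => T (Z ω) ω) Z t 0 - pscore P (fun ω => T (Z ω) ω) Z t 1)
    ∧ (∀ t : Fin (n + 2), t ≠ 1 →
        pscore P (fun ω => T (Z ω) ω) Z t 1 ≤ pscore P (fun ω => T (Z ω) ω) Z t 0) := by
  have hps (z : Fin 2) (t : Fin (n + 2)) :
      pscore P (fun ω => T (Z ω) ω) Z t z = prr P {ω | T z ω = t} :=
    pscore_eq_prr (hZpos z)
      (hindep.comp measurable_id ((measurable_pi_apply z).comp measurable_fst)) t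
  have hresp : ∀ᵐ ω ∂P, T 1 ω = 1 ∨ T 1 ω = T 0 ω := by
    filter_upwards [hmax] with ω hω
    exact eq_or_eq_of_unique_maximizers (u := fun t => u t ω) (hω 0) (hω 1) hΔ1 hΔt
  have hA1 : prr P {ω | T 0 ω = 1 ∧ T 1 ω = 1} = prr P {ω | T 0 ω = 1} := by
    refine congrArg ENNReal.toReal (measure_congr (Filter.eventuallyEq_set.2 ?_))
    filter_upwards [hresp] with ω hω
    grind
  have hA (t : Fin (n + 2)) (ht : t ≠ 1) :
      prr P {ω | T 0 ω = t ∧ T 1 ω = t} = prr P {ω | T 1 ω = t} := by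
    refine congrArg ENNReal.toReal (measure_congr (Filter.eventuallyEq_set.2 ?_))
    filter_upwards [hresp] with ω hω
    grind
  have hC (t : Fin (n + 2)) (ht : t ≠ 1) :
      prr P {ω | T 0 ω = t ∧ T 1 ω = 1} = prr P {ω | T 0 ω = t} - prr P {ω | T 1 ω = t} := by
    have hdiff : prr P ({ω | T 0 ω = t} \ {ω | T 1 ω = 1}) = prr P {ω | T 1 ω = t} := by
      refine congrArg ENNReal.toReal (measure_congr (Filter.eventuallyEq_set.2 ?_))
      filter_upwards [hresp] with ω hω
      simp only [Set.mem_sdiff, Set.mem_ofPred_eq]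
      grind
    rw [eq_sub_iff_add_eq, ← hdiff]
    exact measureReal_inter_add_sdiff (μ := P) (s := {ω | T 0 ω = t})
      (hTmeas 1 (measurableSet_singleton 1))
  simp only [hps]
  refine ⟨hA1, hA, hC, fun t ht => ?_⟩
  rw [← sub_nonneg, ← hC t ht]
  exact ENNReal.toReal_nonneg
end
end

section
/- In the 2×T ARUM with strict one-to-one targeting, assume P(A_1) > 0, P(A_t) > 0, and P(C_{t1}) > 0 for every t ≠ 1. Then: E[Y(1) | A_1] = Ē_0(1) / P(1|0); E[Y(t) | A_t] = Ē_1(t) / P(t|1) for t ≠ 1; E[Y(t) | C_{t1}] = (Ē_0(t) − Ē_1(t)) / (P(t|0) − P(t|1)) for t ≠ 1. Moreover, the Wald estimand satisfies (E[Y | Z = 1] − E[Y | Z = 0]) / (P(1|1) − P(1|0)) = Σ_{t ≠ 1} α_t · E[Y(1) − Y(t) | C_{t1}], where the weights α_t := (P(t|0) − P(t|1)) / (P(1|1) − P(1|0)) are nonnegative and sum to 1. -/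
open MeasureTheory ProbabilityTheory

noncomputable section

variable {Ω : Type*} [MeasurableSpace Ω]

/-- Integrating `F ∘ X` over an event of a variable independent of `X` factorizes. -/
lemma setIntegral_preimage_of_indepFun {α E : Type*} [MeasurableSpace α] [MeasurableSpace E]
    {P : Measure Ω} [IsProbabilityMeasure P] {Z : Ω → α} {X : Ω → E} (h : IndepFun Z X P)
    (hZ : Measurable Z) (hX : Measurable X) {s : Set α} (hs : MeasurableSet s)
    {F : E → ℝ} (hF : Measurable F) :
    ∫ ω in Z ⁻¹' s, F (X ω) ∂P = prr P (Z ⁻¹' s) * ∫ ω, F (X ω) ∂P := by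
  have hind : Measurable (s.indicator (fun _ => (1 : ℝ))) := measurable_const.indicator hs
  have hmul := (h.comp hind hF).integral_fun_mul_eq_mul_integral
    (hind.comp hZ).aestronglyMeasurable (hF.comp hX).aestronglyMeasurable
  have hone : ∫ ω, (s.indicator (fun _ => (1 : ℝ)) ∘ Z) ω ∂P = prr P (Z ⁻¹' s) := by
    change ∫ ω, (Z ⁻¹' s).indicator (fun _ => (1 : ℝ)) ω ∂P = _
    rw [integral_indicator (hZ hs)]
    simp [prr, Measure.real]
  rw [hone] at hmul
  simp only [Function.comp_apply] at hmul
  rw [← hmul, ← integral_indicator (hZ hs)]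
  refine integral_congr_ae (ae_of_all _ fun ω => ?_)
  by_cases hω : Z ω ∈ s <;> simp [Set.indicator, hω]

/-- A set integral splits along the values of a finitely-valued measurable function. -/
lemma setIntegral_eq_sum_fiber {ι : Type*} [Fintype ι] [MeasurableSpace ι]
    [MeasurableSingletonClass ι] {P : Measure Ω} {X : Ω → ι} (hX : Measurable X)
    {S : Set Ω} (hS : MeasurableSet S) {f : Ω → ℝ} (hf : Integrable f P) :
    ∫ ω in S, f ω ∂P = ∑ i, ∫ ω in S ∩ {ω | X ω = i}, f ω ∂P := by
  rw [← integral_iUnion_fintype (s := fun i => S ∩ {ω | X ω = i})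
    (fun i => hS.inter (hX (measurableSet_singleton i))) ?_ fun i => hf.integrableOn]
  · congr 2
    ext ω
    simp
  · intro i j hij
    refine Set.disjoint_left.2 fun ω hi hj => hij ?_
    exact hi.2.symm.trans hj.2

section Model

variable {P : Measure Ω} {ι : Type*} {T : Fin 2 → Ω → ι}

/-- Under strict one-to-one targeting of treatment `a`, switching the instrument on either leaves
the treatment choice unchanged or moves it to `a`. -/
lemma ae_eq_or_eq_of_targeting {U : Fin 2 → ι → ℝ} {u : ι → Ω → ℝ} {o a : ι}
    (hmax : ∀ᵐ ω ∂P, ∀ z t, t ≠ T z ω → U z t + u t ω < U z (T z ω) + u (T z ω) ω)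
    (ha : U 0 a - U 0 o < U 1 a - U 1 o)
    (ht : ∀ t, t ≠ a → U 1 t - U 1 o = U 0 t - U 0 o) :
    ∀ᵐ ω ∂P, T 1 ω = a ∨ T 1 ω = T 0 ω := by
  filter_upwards [hmax] with ω h
  by_contra! hne
  have h0 := h 0 (T 1 ω) hne.2
  have h1 := h 1 (T 0 ω) hne.2.symm
  have e1 := ht _ hne.1
  by_cases h0a : T 0 ω = a
  · rw [h0a] at h0 h1
    linarith
  · have e0 := ht _ h0a
    linarith

variable {a : ι}

lemma setIntegral_cell_eq_zero (hT : ∀ᵐ ω ∂P, T 1 ω = a ∨ T 1 ω = T 0 ω) (f : Ω → ℝ)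
    {s t : ι} (hta : t ≠ a) (hst : s ≠ t) :
    ∫ ω in {ω | T 0 ω = s ∧ T 1 ω = t}, f ω ∂P = 0 := by
  refine setIntegral_measure_zero _ (measure_eq_zero_iff_ae_notMem.2 ?_)
  filter_upwards [hT] with ω hω
  rintro ⟨h0, h1⟩
  rcases hω with h | h
  · exact hta (h1.symm.trans h)
  · exact hst (h0.symm.trans (h.symm.trans h1))

variable [Fintype ι] [MeasurableSpace ι] [MeasurableSingletonClass ι]

lemma setIntegral_untreated_eq_sum (hm : ∀ z, Measurable (T z)) {f : Ω → ℝ}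
    (hf : Integrable f P) (s : ι) :
    ∫ ω in {ω | T 0 ω = s}, f ω ∂P = ∑ t, ∫ ω in {ω | T 0 ω = s ∧ T 1 ω = t}, f ω ∂P :=
  setIntegral_eq_sum_fiber (hm 1) (hm 0 (measurableSet_singleton s)) hf

lemma setIntegral_treated_eq_sum (hm : ∀ z, Measurable (T z)) {f : Ω → ℝ}
    (hf : Integrable f P) (t : ι) :
    ∫ ω in {ω | T 1 ω = t}, f ω ∂P = ∑ s, ∫ ω in {ω | T 0 ω = s ∧ T 1 ω = t}, f ω ∂P := by
  rw [setIntegral_eq_sum_fiber (S := {ω | T 1 ω = t}) (hm 0)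
    (hm 1 (measurableSet_singleton t)) hf]
  refine Finset.sum_congr rfl fun s _ => ?_
  rw [Set.inter_comm]
  rfl

lemma setIntegral_untreated_target (hm : ∀ z, Measurable (T z))
    (hT : ∀ᵐ ω ∂P, T 1 ω = a ∨ T 1 ω = T 0 ω) {f : Ω → ℝ} (hf : Integrable f P) :
    ∫ ω in {ω | T 0 ω = a}, f ω ∂P = ∫ ω in {ω | T 0 ω = a ∧ T 1 ω = a}, f ω ∂P := by
  rw [setIntegral_untreated_eq_sum hm hf]
  exact Finset.sum_eq_single a (fun t _ hta => setIntegral_cell_eq_zero hT f hta hta.symm)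
    (by simp)

lemma setIntegral_treated_of_ne (hm : ∀ z, Measurable (T z))
    (hT : ∀ᵐ ω ∂P, T 1 ω = a ∨ T 1 ω = T 0 ω) {f : Ω → ℝ} (hf : Integrable f P)
    {t : ι} (hta : t ≠ a) :
    ∫ ω in {ω | T 1 ω = t}, f ω ∂P = ∫ ω in {ω | T 0 ω = t ∧ T 1 ω = t}, f ω ∂P := by
  rw [setIntegral_treated_eq_sum hm hf]
  exact Finset.sum_eq_single t (fun s _ hst => setIntegral_cell_eq_zero hT f hta hst) (by simp)

lemma setIntegral_untreated_of_ne (hm : ∀ z, Measurable (T z))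
    (hT : ∀ᵐ ω ∂P, T 1 ω = a ∨ T 1 ω = T 0 ω) {f : Ω → ℝ} (hf : Integrable f P)
    {t : ι} (hta : t ≠ a) :
    ∫ ω in {ω | T 0 ω = t}, f ω ∂P
      = ∫ ω in {ω | T 0 ω = t ∧ T 1 ω = t}, f ω ∂P
        + ∫ ω in {ω | T 0 ω = t ∧ T 1 ω = a}, f ω ∂P := by
  rw [setIntegral_untreated_eq_sum hm hf]
  exact Fintype.sum_eq_add t a hta fun s hs => setIntegral_cell_eq_zero hT f hs.2 hs.1.symm

lemma setIntegral_treated_target [DecidableEq ι] (hm : ∀ z, Measurable (T z)) {f : Ω → ℝ}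
    (hf : Integrable f P) :
    ∫ ω in {ω | T 1 ω = a}, f ω ∂P
      = ∫ ω in {ω | T 0 ω = a ∧ T 1 ω = a}, f ω ∂P
        + ∑ t ∈ Finset.univ.erase a, ∫ ω in {ω | T 0 ω = t ∧ T 1 ω = a}, f ω ∂P := by
  rw [setIntegral_treated_eq_sum hm hf]
  exact (Finset.add_sum_erase _ _ (Finset.mem_univ a)).symm

variable {Z : Ω → Fin 2} {Y : ι → Ω → ℝ}

lemma setIntegral_observed [IsProbabilityMeasure P] (hm : ∀ z, Measurable (T z))
    (hZ : Measurable Z) (hY : ∀ t, Measurable (Y t))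
    (h : IndepFun Z (fun ω => ((fun z => T z ω), (fun t => Y t ω))) P) (z : Fin 2) (t : ι)
    {φ : ℝ → ℝ} (hφ : Measurable φ) :
    ∫ ω in {ω | T (Z ω) ω = t} ∩ {ω | Z ω = z}, φ (Y (T (Z ω) ω) ω) ∂P
      = prr P {ω | Z ω = z} * ∫ ω in {ω | T z ω = t}, φ (Y t ω) ∂P := by
  have hset : {ω | T (Z ω) ω = t} ∩ {ω | Z ω = z} = {ω | Z ω = z} ∩ {ω | T z ω = t} := by
    ext ω
    constructor
    · rintro ⟨h1, h2 : Z ω = z⟩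
      exact ⟨h2, by simpa [h2] using h1⟩
    · rintro ⟨h2 : Z ω = z, h1⟩
      exact ⟨by simpa [h2] using h1, h2⟩
  have hTz : MeasurableSet {ω | T z ω = t} := hm z (measurableSet_singleton t)
  have hZz : MeasurableSet {ω | Z ω = z} := hZ (measurableSet_singleton z)
  have hE : MeasurableSet {e : (Fin 2 → ι) × (ι → ℝ) | e.1 z = t} :=
    measurableSet_eq_fun ((measurable_pi_apply z).comp measurable_fst) measurable_const
  have hF : Measurable ({e : (Fin 2 → ι) × (ι → ℝ) | e.1 z = t}.indicator fun e => φ (e.2 t)) :=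
    (hφ.comp ((measurable_pi_apply t).comp measurable_snd)).indicator hE
  have hX : Measurable fun ω => ((fun z => T z ω), (fun t => Y t ω)) :=
    (measurable_pi_lambda _ hm).prodMk (measurable_pi_lambda _ hY)
  have key := setIntegral_preimage_of_indepFun h hZ hX (measurableSet_singleton z) hF
  have hind : ∀ ω, {e : (Fin 2 → ι) × (ι → ℝ) | e.1 z = t}.indicator (fun e => φ (e.2 t))
      ((fun z => T z ω), (fun t => Y t ω))
        = {ω | T z ω = t}.indicator (fun ω => φ (Y t ω)) ω := fun ω => rfl
  simp only [hind] at key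
  rw [setIntegral_indicator hTz, integral_indicator hTz] at key
  rw [hset, setIntegral_congr_fun (g := fun ω => φ (Y t ω)) (hZz.inter hTz)]
  · exact key
  · rintro ω ⟨h2 : Z ω = z, h1 : T z ω = t⟩
    simp [h2, h1]

lemma ebar_observed [IsProbabilityMeasure P] (hm : ∀ z, Measurable (T z))
    (hZ : Measurable Z) (hY : ∀ t, Measurable (Y t))
    (h : IndepFun Z (fun ω => ((fun z => T z ω), (fun t => Y t ω))) P) {z : Fin 2}
    (hz : prr P {ω | Z ω = z} ≠ 0) (t : ι) :
    ebar P (fun ω => T (Z ω) ω) Z (fun ω => Y (T (Z ω) ω) ω) z t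
      = ∫ ω in {ω | T z ω = t}, Y t ω ∂P := by
  rw [ebar, setIntegral_observed hm hZ hY h z t measurable_id', mul_div_cancel_left₀ _ hz]

lemma prr_eq_setIntegral (A : Set Ω) : prr P A = ∫ _ in A, (1 : ℝ) ∂P := by
  simp [prr, Measure.real]

lemma pscore_observed [IsProbabilityMeasure P] (hm : ∀ z, Measurable (T z))
    (hZ : Measurable Z) (hY : ∀ t, Measurable (Y t))
    (h : IndepFun Z (fun ω => ((fun z => T z ω), (fun t => Y t ω))) P) {z : Fin 2}
    (hz : prr P {ω | Z ω = z} ≠ 0) (t : ι) :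
    pscore P (fun ω => T (Z ω) ω) Z t z = ∫ _ in {ω | T z ω = t}, (1 : ℝ) ∂P := by
  have key := setIntegral_observed hm hZ hY h z t (measurable_const (a := (1 : ℝ)))
  rw [pscore, prr_eq_setIntegral (_ ∩ _), key, mul_div_cancel_left₀ _ hz]

lemma integrable_of_finite_choice {D : Ω → ι} (hD : Measurable D)
    (hYi : ∀ t, Integrable (Y t) P) : Integrable (fun ω => Y (D ω) ω) P := by
  classical
  have heq : (fun ω => Y (D ω) ω) = fun ω => ∑ t, {ω | D ω = t}.indicator (Y t) ω := by
    ext ω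
    simp [Set.indicator_apply]
  rw [heq]
  exact integrable_finsetSum _ fun t _ => (hYi t).indicator (hD (measurableSet_singleton t))

lemma ecz_observed [IsProbabilityMeasure P] (hm : ∀ z, Measurable (T z))
    (hZ : Measurable Z) (hY : ∀ t, Measurable (Y t)) (hYi : ∀ t, Integrable (Y t) P)
    (h : IndepFun Z (fun ω => ((fun z => T z ω), (fun t => Y t ω))) P) {z : Fin 2}
    (hz : prr P {ω | Z ω = z} ≠ 0) :
    ecz P Z (fun ω => Y (T (Z ω) ω) ω) z = ∑ t, ∫ ω in {ω | T z ω = t}, Y t ω ∂P := by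
  have hD : Measurable fun ω => T (Z ω) ω :=
    (measurable_from_prod_countable_right hm (f := fun p : Fin 2 × Ω => T p.1 p.2)).comp
      (hZ.prodMk measurable_id)
  have hZz : MeasurableSet {ω | Z ω = z} := hZ (measurableSet_singleton z)
  rw [ecz, setIntegral_eq_sum_fiber hD hZz (integrable_of_finite_choice hD hYi), Finset.sum_div]
  refine Finset.sum_congr rfl fun t _ => ?_
  rw [← ebar_observed hm hZ hY h hz t, ebar, Set.inter_comm]

end Model

/-- Proposition (identification in the 2×T model under strict, one-to-one targeting):
counterfactual means for always-takers and compliers, and the Wald estimand as a convex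
combination of the complier treatment effects. -/
theorem statement10
    (P : Measure Ω) [IsProbabilityMeasure P] (n : ℕ)
    (T : Fin 2 → Ω → Fin (n + 2)) (Z : Ω → Fin 2) (Y : Fin (n + 2) → Ω → ℝ)
    (U : Fin 2 → Fin (n + 2) → ℝ) (u : Fin (n + 2) → Ω → ℝ)
    (hTmeas : ∀ z, Measurable (T z)) (hZmeas : Measurable Z)
    (hYmeas : ∀ t, Measurable (Y t)) (hYint : ∀ t, Integrable (Y t) P)
    (humeas : ∀ t, Measurable (u t))
    (hZpos : ∀ z, 0 < P {ω | Z ω = z})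
    (hindep : IndepFun Z
      (fun ω => ((fun z => T z ω), (fun t => Y t ω), (fun t => u t ω))) P)
    (hmax : ∀ᵐ ω ∂P, ∀ z t, t ≠ T z ω →
      U z t + u t ω < U z (T z ω) + u (T z ω) ω)
    (hΔ1 : U 0 1 - U 0 0 < U 1 1 - U 1 0)
    (hΔt : ∀ t : Fin (n + 2), t ≠ 1 → U 1 t - U 1 0 = U 0 t - U 0 0)
    -- positive group probabilities
    (hA1 : 0 < P {ω | T 0 ω = 1 ∧ T 1 ω = 1})
    (hAt : ∀ t : Fin (n + 2), t ≠ 1 → 0 < P {ω | T 0 ω = t ∧ T 1 ω = t})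
    (hCt : ∀ t : Fin (n + 2), t ≠ 1 → 0 < P {ω | T 0 ω = t ∧ T 1 ω = 1}) :
    cexp P (Y 1) {ω | T 0 ω = 1 ∧ T 1 ω = 1}
        = ebar P (fun ω => T (Z ω) ω) Z (fun ω => Y (T (Z ω) ω) ω) 0 1
          / pscore P (fun ω => T (Z ω) ω) Z 1 0
    ∧ (∀ t : Fin (n + 2), t ≠ 1 →
        cexp P (Y t) {ω | T 0 ω = t ∧ T 1 ω = t}
          = ebar P (fun ω => T (Z ω) ω) Z (fun ω => Y (T (Z ω) ω) ω) 1 t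
            / pscore P (fun ω => T (Z ω) ω) Z t 1)
    ∧ (∀ t : Fin (n + 2), t ≠ 1 →
        cexp P (Y t) {ω | T 0 ω = t ∧ T 1 ω = 1}
          = (ebar P (fun ω => T (Z ω) ω) Z (fun ω => Y (T (Z ω) ω) ω) 0 t
              - ebar P (fun ω => T (Z ω) ω) Z (fun ω => Y (T (Z ω) ω) ω) 1 t)
            / (pscore P (fun ω => T (Z ω) ω) Z t 0 - pscore P (fun ω => T (Z ω) ω) Z t 1))
    -- the Wald estimand is a convex combination of complier treatment effects
    ∧ (ecz P Z (fun ω => Y (T (Z ω) ω) ω) 1 - ecz P Z (fun ω => Y (T (Z ω) ω) ω) 0)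
        / (pscore P (fun ω => T (Z ω) ω) Z 1 1 - pscore P (fun ω => T (Z ω) ω) Z 1 0)
      = ∑ t ∈ Finset.univ.erase 1,
          ((pscore P (fun ω => T (Z ω) ω) Z t 0 - pscore P (fun ω => T (Z ω) ω) Z t 1)
              / (pscore P (fun ω => T (Z ω) ω) Z 1 1 - pscore P (fun ω => T (Z ω) ω) Z 1 0))
            * cexp P (fun ω => Y 1 ω - Y t ω) {ω | T 0 ω = t ∧ T 1 ω = 1}
    ∧ (∀ t : Fin (n + 2), t ≠ 1 →
        0 ≤ (pscore P (fun ω => T (Z ω) ω) Z t 0 - pscore P (fun ω => T (Z ω) ω) Z t 1)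
            / (pscore P (fun ω => T (Z ω) ω) Z 1 1 - pscore P (fun ω => T (Z ω) ω) Z 1 0))
    ∧ ∑ t ∈ Finset.univ.erase 1,
        (pscore P (fun ω => T (Z ω) ω) Z t 0 - pscore P (fun ω => T (Z ω) ω) Z t 1)
          / (pscore P (fun ω => T (Z ω) ω) Z 1 1 - pscore P (fun ω => T (Z ω) ω) Z 1 0)
        = 1 := by
  have hT := ae_eq_or_eq_of_targeting hmax hΔ1 hΔt
  have hZ0 : ∀ z, prr P {ω | Z ω = z} ≠ 0 := fun z =>
    (ENNReal.toReal_pos (hZpos z).ne' (measure_ne_top _ _)).ne'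
  have hind : IndepFun Z (fun ω => ((fun z => T z ω), (fun t => Y t ω))) P :=
    hindep.comp measurable_id
      (measurable_fst.prodMk (measurable_fst.comp measurable_snd))
  have h1 : Integrable (fun _ : Ω => (1 : ℝ)) P := integrable_const 1
  have hC : ∀ t, t ≠ 1 → 0 < ∫ _ in {ω | T 0 ω = t ∧ T 1 ω = 1}, (1 : ℝ) ∂P := fun t ht => by
    rw [← prr_eq_setIntegral]
    exact ENNReal.toReal_pos (hCt t ht).ne' (measure_ne_top _ _)
  have hp : ∀ t, t ≠ 1 → pscore P (fun ω => T (Z ω) ω) Z t 0 - pscore P (fun ω => T (Z ω) ω) Z t 1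
      = ∫ _ in {ω | T 0 ω = t ∧ T 1 ω = 1}, (1 : ℝ) ∂P := fun t ht => by
    rw [pscore_observed hTmeas hZmeas hYmeas hind (hZ0 0),
      pscore_observed hTmeas hZmeas hYmeas hind (hZ0 1),
      setIntegral_untreated_of_ne hTmeas hT h1 ht, setIntegral_treated_of_ne hTmeas hT h1 ht,
      add_sub_cancel_left]
  have hq : pscore P (fun ω => T (Z ω) ω) Z 1 1 - pscore P (fun ω => T (Z ω) ω) Z 1 0
      = ∑ t ∈ Finset.univ.erase 1, ∫ _ in {ω | T 0 ω = t ∧ T 1 ω = 1}, (1 : ℝ) ∂P := by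
    rw [pscore_observed hTmeas hZmeas hYmeas hind (hZ0 0),
      pscore_observed hTmeas hZmeas hYmeas hind (hZ0 1),
      setIntegral_untreated_target hTmeas hT h1, setIntegral_treated_target hTmeas h1,
      add_sub_cancel_left]
  have hqpos : 0 < ∑ t ∈ Finset.univ.erase (1 : Fin (n + 2)),
      ∫ _ in {ω | T 0 ω = t ∧ T 1 ω = 1}, (1 : ℝ) ∂P :=
    Finset.sum_pos (fun t ht => hC t (Finset.ne_of_mem_erase ht)) ⟨0, by simp⟩
  refine ⟨?_, fun t ht => ?_, fun t ht => ?_, ?_, fun t ht => ?_, ?_⟩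
  · rw [ebar_observed hTmeas hZmeas hYmeas hind (hZ0 0),
      pscore_observed hTmeas hZmeas hYmeas hind (hZ0 0),
      setIntegral_untreated_target hTmeas hT h1,
      setIntegral_untreated_target hTmeas hT (hYint 1), cexp, prr_eq_setIntegral]
  · rw [ebar_observed hTmeas hZmeas hYmeas hind (hZ0 1),
      pscore_observed hTmeas hZmeas hYmeas hind (hZ0 1),
      setIntegral_treated_of_ne hTmeas hT h1 ht,
      setIntegral_treated_of_ne hTmeas hT (hYint t) ht, cexp, prr_eq_setIntegral]
  · rw [hp t ht, ebar_observed hTmeas hZmeas hYmeas hind (hZ0 0),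
      ebar_observed hTmeas hZmeas hYmeas hind (hZ0 1),
      setIntegral_untreated_of_ne hTmeas hT (hYint t) ht,
      setIntegral_treated_of_ne hTmeas hT (hYint t) ht, add_sub_cancel_left, cexp,
      prr_eq_setIntegral]
  · have hnum : ecz P Z (fun ω => Y (T (Z ω) ω) ω) 1 - ecz P Z (fun ω => Y (T (Z ω) ω) ω) 0
        = ∑ t ∈ Finset.univ.erase 1,
            ∫ ω in {ω | T 0 ω = t ∧ T 1 ω = 1}, (Y 1 ω - Y t ω) ∂P := by
      rw [ecz_observed hTmeas hZmeas hYmeas hYint hind (hZ0 1),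
        ecz_observed hTmeas hZmeas hYmeas hYint hind (hZ0 0), ← Finset.sum_sub_distrib,
        ← Finset.add_sum_erase _ _ (Finset.mem_univ 1),
        setIntegral_untreated_target hTmeas hT (hYint 1),
        setIntegral_treated_target hTmeas (hYint 1), add_sub_cancel_left,
        ← Finset.sum_add_distrib]
      refine Finset.sum_congr rfl fun t ht => ?_
      have ht1 := Finset.ne_of_mem_erase ht
      rw [setIntegral_untreated_of_ne hTmeas hT (hYint t) ht1,
        setIntegral_treated_of_ne hTmeas hT (hYint t) ht1,
        integral_sub (hYint 1).integrableOn (hYint t).integrableOn]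
      ring
    rw [hnum, hq, Finset.sum_div]
    refine Finset.sum_congr rfl fun t ht => ?_
    have ht1 := Finset.ne_of_mem_erase ht
    have hpos := (hC t ht1).ne'
    rw [hp t ht1, cexp, prr_eq_setIntegral, div_mul_div_comm, mul_comm,
      mul_div_mul_right _ _ hpos]
  · rw [hp t ht, hq]
    exact div_nonneg (hC t ht).le hqpos.le
  · rw [hq, ← Finset.sum_div,
      Finset.sum_congr rfl fun t ht => hp t (Finset.ne_of_mem_erase ht)]
    exact div_self hqpos.ne'
end
end

section
/- In the 2×T ARUM with strict one-to-one targeting, assume P(C_{t1}) > 0 for every t ≠ 1 and that the average counterfactual outcome under treatment 1 is identical across complier groups: E[Y(1) | C_{t1}] does not depend on t ≠ 1. Then for every t ≠ 1 the average treatment effect on the compliers C_{t1} is point-identified: E[Y(1) − Y(t) | C_{t1}] = (Ē_1(1) − Ē_0(1)) / (P(1|1) − P(1|0)) − (Ē_0(t) − Ē_1(t)) / (P(t|0) − P(t|1)). -/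
open MeasureTheory ProbabilityTheory

noncomputable section

variable {Ω : Type*} [MeasurableSpace Ω]

/-- The observed outcome restricted to `{D = d, Z = z}` has conditional mean `E[X · 1_A]`, when
`D = d` is `A` and `Yobs` is `X` on these events, and `X · 1_A` is independent of `Z`. -/
theorem ebar_eq_setIntegral_of_indepFun {𝒟 : Type*} (P : Measure Ω) [IsProbabilityMeasure P]
    {Z : Ω → Fin 2} (hZ : Measurable Z) {z : Fin 2} (hz : 0 < P {ω | Z ω = z})
    {D : Ω → 𝒟} {d : 𝒟} {Yobs X : Ω → ℝ} {A : Set Ω} (hA : MeasurableSet A)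
    (hX : Measurable X) (hDA : ∀ ω, Z ω = z → (D ω = d ↔ ω ∈ A))
    (hYX : ∀ ω, Z ω = z → ω ∈ A → Yobs ω = X ω)
    (hind : IndepFun Z (A.indicator X) P) :
    ebar P D Z Yobs z d = ∫ ω in A, X ω ∂P := by
  have hmeas : MeasurableSet {ω | Z ω = z} := hZ (measurableSet_singleton z)
  have hset : {ω | D ω = d} ∩ {ω | Z ω = z} = A ∩ {ω | Z ω = z} := by
    ext ω
    simp only [Set.mem_inter_iff, Set.mem_ofPred_eq]
    exact ⟨fun h => ⟨(hDA ω h.2).1 h.1, h.2⟩, fun h => ⟨(hDA ω h.2).2 h.1, h.2⟩⟩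
  have hpos : prr P {ω | Z ω = z} ≠ 0 :=
    (ENNReal.toReal_pos hz.ne' (measure_ne_top P _)).ne'
  have hcomp : IndepFun ({ω | Z ω = z}.indicator (fun _ => (1 : ℝ))) (A.indicator X) P := by
    have := hind.comp (φ := ({z} : Set (Fin 2)).indicator (fun _ => (1 : ℝ))) (ψ := id)
      (measurable_of_finite _) measurable_id
    exact this
  have hmul := hcomp.integral_mul_eq_mul_integral
    (measurable_const.indicator hmeas).aestronglyMeasurable
    (hX.indicator hA).aestronglyMeasurable
  have hprod : {ω | Z ω = z}.indicator (fun _ => (1 : ℝ)) * A.indicator X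
      = (A ∩ {ω | Z ω = z}).indicator X := by
    ext ω
    by_cases h1 : Z ω = z <;> by_cases h2 : ω ∈ A <;> simp [h1, h2]
  rw [hprod, integral_indicator (hA.inter hmeas), integral_indicator hmeas,
    integral_indicator hA] at hmul
  rw [ebar, hset, setIntegral_congr_fun (hA.inter hmeas) (fun ω h => hYX ω h.2 h.1), hmul,
    div_eq_iff hpos]
  simp [prr, measureReal_def, mul_comm]

/-- The propensity score is the conditional average of the constant outcome `1`. -/
theorem pscore_eq_ebar_one {𝒟 𝒵 : Type*} (P : Measure Ω) (D : Ω → 𝒟) (Z : Ω → 𝒵) (d : 𝒟)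
    (z : 𝒵) : pscore P D Z d z = ebar P D Z (fun _ => 1) z d := by
  simp [pscore, ebar, prr, measureReal_def]

/-- Under strict one-to-one targeting, switching the instrument on can only move an individual
into treatment `1`. -/
theorem eq_or_eq_one_of_targeting {n : ℕ} {U : Fin 2 → Fin (n + 2) → ℝ} {v : Fin (n + 2) → ℝ}
    {τ : Fin 2 → Fin (n + 2)} (hmax : ∀ z t, t ≠ τ z → U z t + v t < U z (τ z) + v (τ z))
    (hΔ1 : U 0 1 - U 0 0 < U 1 1 - U 1 0)
    (hΔt : ∀ t : Fin (n + 2), t ≠ 1 → U 1 t - U 1 0 = U 0 t - U 0 0) :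
    τ 1 = τ 0 ∨ τ 1 = 1 := by
  by_contra! h
  have h0 := hmax 0 (τ 1) h.1
  have h1 := hmax 1 (τ 0) h.1.symm
  have hb := hΔt _ h.2
  by_cases ha : τ 0 = 1
  · rw [ha] at h0 h1
    linarith
  · have := hΔt _ ha
    linarith

/-- If `S` and `R` almost surely satisfy `R = S` or `R = 1`, the integrals over `{S = t}` and
`{R = t}` differ by the integral over the compliers from `t ≠ 1`. -/
theorem setIntegral_sub_setIntegral_eq_complier {n : ℕ} (P : Measure Ω)
    {S R : Ω → Fin (n + 2)} (hS : Measurable S) (hR : Measurable R)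
    (hSR : ∀ᵐ ω ∂P, R ω = S ω ∨ R ω = 1) {f : Ω → ℝ} (hf : Integrable f P)
    {t : Fin (n + 2)} (ht : t ≠ 1) :
    ∫ ω in {ω | S ω = t}, f ω ∂P - ∫ ω in {ω | R ω = t}, f ω ∂P
      = ∫ ω in {ω | S ω = t ∧ R ω = 1}, f ω ∂P := by
  have mS : MeasurableSet {ω | S ω = t} := hS (measurableSet_singleton t)
  have mR (s) : MeasurableSet {ω | R ω = s} := hR (measurableSet_singleton s)
  have mC : MeasurableSet {ω | S ω = t ∧ R ω = 1} := mS.inter (mR 1)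
  rw [← integral_indicator mS, ← integral_indicator (mR t), ← integral_indicator mC,
    ← integral_sub (hf.indicator mS) (hf.indicator (mR t))]
  refine integral_congr_ae ?_
  filter_upwards [hSR] with ω hω
  simp only [Set.indicator_apply, Set.mem_ofPred_eq]
  grind

/-- If `S` and `R` almost surely satisfy `R = S` or `R = 1`, the integrals over `{R = 1}` and
`{S = 1}` differ by the sum of the integrals over all complier groups. -/
theorem setIntegral_sub_setIntegral_eq_sum_complier {n : ℕ} (P : Measure Ω)
    {S R : Ω → Fin (n + 2)} (hS : Measurable S) (hR : Measurable R)
    (hSR : ∀ᵐ ω ∂P, R ω = S ω ∨ R ω = 1) {f : Ω → ℝ} (hf : Integrable f P) :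
    ∫ ω in {ω | R ω = 1}, f ω ∂P - ∫ ω in {ω | S ω = 1}, f ω ∂P
      = ∑ t ∈ Finset.univ.erase (1 : Fin (n + 2)), ∫ ω in {ω | S ω = t ∧ R ω = 1}, f ω ∂P := by
  have mS (s) : MeasurableSet {ω | S ω = s} := hS (measurableSet_singleton s)
  have mR : MeasurableSet {ω | R ω = 1} := hR (measurableSet_singleton 1)
  have mC (t) : MeasurableSet {ω | S ω = t ∧ R ω = 1} := (mS t).inter mR
  simp_rw [← integral_indicator mR, ← integral_indicator (mS 1), ← integral_indicator (mC _)]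
  rw [← integral_sub (hf.indicator mR) (hf.indicator (mS 1)),
    ← integral_finsetSum _ (fun t _ => hf.indicator (mC t))]
  refine integral_congr_ae ?_
  filter_upwards [hSR] with ω hω
  simp only [Set.indicator_apply, Set.mem_ofPred_eq]
  by_cases hr : R ω = 1
  · by_cases hs : S ω = 1 <;> simp [hr, hs, Finset.sum_ite_eq]
  · have hs : S ω ≠ 1 := by grind
    simp [hr, hs]

/-- Corollary (point-identifying treatment effects in the 2×T model): under homogeneity
of `E[Y(1) | C_{t1}]` across complier groups, each complier average treatment effect is
point-identified. -/
theorem statement11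
    (P : Measure Ω) [IsProbabilityMeasure P] (n : ℕ)
    (T : Fin 2 → Ω → Fin (n + 2)) (Z : Ω → Fin 2) (Y : Fin (n + 2) → Ω → ℝ)
    (U : Fin 2 → Fin (n + 2) → ℝ) (u : Fin (n + 2) → Ω → ℝ)
    (hTmeas : ∀ z, Measurable (T z)) (hZmeas : Measurable Z)
    (hYmeas : ∀ t, Measurable (Y t)) (hYint : ∀ t, Integrable (Y t) P)
    (humeas : ∀ t, Measurable (u t))
    (hZpos : ∀ z, 0 < P {ω | Z ω = z})
    (hindep : IndepFun Z
      (fun ω => ((fun z => T z ω), (fun t => Y t ω), (fun t => u t ω))) P)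
    (hmax : ∀ᵐ ω ∂P, ∀ z t, t ≠ T z ω →
      U z t + u t ω < U z (T z ω) + u (T z ω) ω)
    (hΔ1 : U 0 1 - U 0 0 < U 1 1 - U 1 0)
    (hΔt : ∀ t : Fin (n + 2), t ≠ 1 → U 1 t - U 1 0 = U 0 t - U 0 0)
    (hCt : ∀ t : Fin (n + 2), t ≠ 1 → 0 < P {ω | T 0 ω = t ∧ T 1 ω = 1})
    -- homogeneity: E[Y(1) | C_{t1}] does not depend on t ≠ 1
    (hhom : ∀ t t' : Fin (n + 2), t ≠ 1 → t' ≠ 1 →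
      cexp P (Y 1) {ω | T 0 ω = t ∧ T 1 ω = 1}
        = cexp P (Y 1) {ω | T 0 ω = t' ∧ T 1 ω = 1}) :
    ∀ t : Fin (n + 2), t ≠ 1 →
      cexp P (fun ω => Y 1 ω - Y t ω) {ω | T 0 ω = t ∧ T 1 ω = 1}
        = (ebar P (fun ω => T (Z ω) ω) Z (fun ω => Y (T (Z ω) ω) ω) 1 1
            - ebar P (fun ω => T (Z ω) ω) Z (fun ω => Y (T (Z ω) ω) ω) 0 1)
          / (pscore P (fun ω => T (Z ω) ω) Z 1 1 - pscore P (fun ω => T (Z ω) ω) Z 1 0)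
        - (ebar P (fun ω => T (Z ω) ω) Z (fun ω => Y (T (Z ω) ω) ω) 0 t
            - ebar P (fun ω => T (Z ω) ω) Z (fun ω => Y (T (Z ω) ω) ω) 1 t)
          / (pscore P (fun ω => T (Z ω) ω) Z t 0 - pscore P (fun ω => T (Z ω) ω) Z t 1) := by
  intro t ht
  have hmono : ∀ᵐ ω ∂P, T 1 ω = T 0 ω ∨ T 1 ω = 1 := by
    filter_upwards [hmax] with ω hω
    exact eq_or_eq_one_of_targeting (τ := fun z => T z ω) (v := fun t => u t ω) hω hΔ1 hΔt
  have mT (z : Fin 2) (d : Fin (n + 2)) : MeasurableSet {ω | T z ω = d} :=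
    hTmeas z (measurableSet_singleton d)
  have mSet (z : Fin 2) (d : Fin (n + 2)) : MeasurableSet
      {p : (Fin 2 → Fin (n + 2)) × (Fin (n + 2) → ℝ) × (Fin (n + 2) → ℝ) | p.1 z = d} :=
    measurableSet_eq_fun ((measurable_pi_apply z).comp measurable_fst) measurable_const
  have hebar (z : Fin 2) (d : Fin (n + 2)) :
      ebar P (fun ω => T (Z ω) ω) Z (fun ω => Y (T (Z ω) ω) ω) z d
        = ∫ ω in {ω | T z ω = d}, Y d ω ∂P := by
    refine ebar_eq_setIntegral_of_indepFun P hZmeas (hZpos z) (mT z d) (hYmeas d)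
      (fun ω h => by simp [h]) (fun ω h hd => ?_) ?_
    · have hd' : T z ω = d := hd
      simp [h, hd']
    · exact hindep.comp measurable_id
        (((measurable_pi_apply d).comp (measurable_fst.comp measurable_snd)).indicator (mSet z d))
  have hpscore (z : Fin 2) (d : Fin (n + 2)) :
      pscore P (fun ω => T (Z ω) ω) Z d z = ∫ ω in {ω | T z ω = d}, (1 : ℝ) ∂P := by
    rw [pscore_eq_ebar_one]
    refine ebar_eq_setIntegral_of_indepFun P hZmeas (hZpos z) (mT z d) measurable_const
      (fun ω h => by simp [h]) (fun _ _ _ => rfl) ?_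
    exact hindep.comp measurable_id ((measurable_const (a := (1 : ℝ))).indicator (mSet z d))
  have h1 : Integrable (fun _ : Ω => (1 : ℝ)) P := integrable_const 1
  have hprr (A : Set Ω) : ∫ _ in A, (1 : ℝ) ∂P = prr P A := by simp [prr, measureReal_def]
  have hpos (s : Fin (n + 2)) (hs : s ≠ 1) : 0 < prr P {ω | T 0 ω = s ∧ T 1 ω = 1} :=
    ENNReal.toReal_pos (hCt s hs).ne' (measure_ne_top P _)
  simp only [hebar, hpscore]
  rw [setIntegral_sub_setIntegral_eq_sum_complier P (hTmeas 0) (hTmeas 1) hmono (hYint 1),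
    setIntegral_sub_setIntegral_eq_sum_complier P (hTmeas 0) (hTmeas 1) hmono h1,
    setIntegral_sub_setIntegral_eq_complier P (hTmeas 0) (hTmeas 1) hmono (hYint t) ht,
    setIntegral_sub_setIntegral_eq_complier P (hTmeas 0) (hTmeas 1) hmono h1 ht]
  simp only [hprr]
  have hsum : ∑ s ∈ Finset.univ.erase (1 : Fin (n + 2)),
        ∫ ω in {ω | T 0 ω = s ∧ T 1 ω = 1}, Y 1 ω ∂P
      = cexp P (Y 1) {ω | T 0 ω = t ∧ T 1 ω = 1}
        * ∑ s ∈ Finset.univ.erase (1 : Fin (n + 2)), prr P {ω | T 0 ω = s ∧ T 1 ω = 1} := by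
    rw [Finset.mul_sum]
    refine Finset.sum_congr rfl fun s hs => ?_
    have hs1 : s ≠ 1 := Finset.ne_of_mem_erase hs
    rw [hhom t s ht hs1, cexp, div_mul_cancel₀ _ (hpos s hs1).ne']
  have hsumpos :
      0 < ∑ s ∈ Finset.univ.erase (1 : Fin (n + 2)), prr P {ω | T 0 ω = s ∧ T 1 ω = 1} :=
    Finset.sum_pos (fun s hs => hpos s (Finset.ne_of_mem_erase hs))
      ⟨t, Finset.mem_erase.2 ⟨ht, Finset.mem_univ t⟩⟩
  rw [hsum, mul_div_cancel_right₀ _ hsumpos.ne']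
  simp only [cexp]
  rw [integral_sub (hYint 1).integrableOn (hYint t).integrableOn, sub_div]
end
end

section
/- In the 3×3 ARUM with strict one-to-one targeting, assume the eight response groups A_0, A_1, A_2, C_{010}, C_{002}, C_{012}, C_{112}, C_{212} all have positive probability and the denominators below are nonzero. Then the following counterfactual means are point-identified: E[Y(1) | A_1] = Ē_2(1) / P(1|2); E[Y(2) | A_2] = Ē_1(2) / P(2|1); E[Y(0) | C_{010} ∪ C_{012}] = (Ē_0(0) − Ē_1(0)) / (P(0|0) − P(0|1)); E[Y(0) | C_{002} ∪ C_{012}] = (Ē_0(0) − Ē_2(0)) / (P(0|0) − P(0|2)); E[Y(1) | C_{010} ∪ C_{012} ∪ C_{212}] = (Ē_1(1) − Ē_0(1)) / (P(1|1) − P(1|0)); E[Y(1) | C_{112}] = (Ē_0(1) − Ē_2(1)) / (P(1|0) − P(1|2)); E[Y(2) | C_{002} ∪ C_{012} ∪ C_{112}] = (Ē_2(2) − Ē_0(2)) / (P(2|2) − P(2|0)); E[Y(2) | C_{212}] = (Ē_0(2) − Ē_1(2)) / (P(2|0) − P(2|1)). -/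
open MeasureTheory ProbabilityTheory

noncomputable section

variable {Ω : Type*} [MeasurableSpace Ω]

/-- Response group `C_{abc} = {T(0) = a, T(1) = b, T(2) = c}` of the 3×3 model. -/
def grp3 {Ω : Type*} (T : Fin 3 → Ω → Fin 3) (a b c : Fin 3) : Set Ω :=
  {ω | T 0 ω = a ∧ T 1 ω = b ∧ T 2 ω = c}

/-- The response types compatible with strict one-to-one targeting. -/
theorem arum_response_types (U : Fin 3 → Fin 3 → ℝ) (v : Fin 3 → ℝ) (τ : Fin 3 → Fin 3)
    (hmax : ∀ z t, t ≠ τ z → U z t + v t < U z (τ z) + v (τ z))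
    (h11 : U 0 1 - U 0 0 < U 1 1 - U 1 0) (h21 : U 0 1 - U 0 0 = U 2 1 - U 2 0)
    (h22 : U 0 2 - U 0 0 < U 2 2 - U 2 0) (h12 : U 0 2 - U 0 0 = U 1 2 - U 1 0) :
    (τ 0 = 0 ∧ (τ 1 = 0 ∨ τ 1 = 1) ∧ (τ 2 = 0 ∨ τ 2 = 2)) ∨
      (τ 0 = 1 ∧ τ 1 = 1 ∧ (τ 2 = 1 ∨ τ 2 = 2)) ∨
      (τ 0 = 2 ∧ (τ 1 = 2 ∨ τ 1 = 1) ∧ τ 2 = 2) := by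
  have h0 := hmax 0
  have h1 := hmax 1
  have h2 := hmax 2
  clear hmax
  generalize τ 0 = a at *
  generalize τ 1 = b at *
  generalize τ 2 = c at *
  fin_cases a <;> fin_cases b <;> fin_cases c <;> simp [Fin.forall_fin_succ] at * <;> linarith

/-- The part of an event that is independent of the instrument factors out of an integral. -/
theorem setIntegral_inter_of_indepFun {𝒵 β : Type*} [MeasurableSpace 𝒵] [MeasurableSpace β]
    {P : Measure Ω} [IsProbabilityMeasure P] {Z : Ω → 𝒵} {W : Ω → β} (hZ : Measurable Z)
    (hW : Measurable W) (hind : IndepFun Z W P) {A : Set 𝒵} (hA : MeasurableSet A)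
    {B : Set β} (hB : MeasurableSet B) {g : β → ℝ} (hg : Measurable g) :
    ∫ ω in W ⁻¹' B ∩ Z ⁻¹' A, g (W ω) ∂P
      = P.real (Z ⁻¹' A) * ∫ ω in W ⁻¹' B, g (W ω) ∂P := by
  have h := (hind.comp (measurable_one.indicator hA : Measurable (A.indicator (1 : 𝒵 → ℝ)))
    (hg.indicator hB)).integral_fun_mul_eq_mul_integral
    ((measurable_one.indicator hA).comp hZ).aestronglyMeasurable
    ((hg.indicator hB).comp hW).aestronglyMeasurable
  rw [← integral_indicator_one (hZ hA), ← integral_indicator (hW hB),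
    ← integral_indicator ((hW hB).inter (hZ hA))]
  refine Eq.trans (integral_congr_ae (Filter.Eventually.of_forall fun ω => ?_)) h
  by_cases hz : Z ω ∈ A <;> by_cases hw : W ω ∈ B <;> simp [Set.indicator, hz, hw]

/-- If `S` splits, up to a null set, into `C` and `S'`, the mean over `C` is a Wald ratio. -/
theorem cexp_eq_wald {P : Measure Ω} [IsProbabilityMeasure P] {X : Ω → ℝ} (hX : Integrable X P)
    {C S S' : Set Ω} (hS' : MeasurableSet S')
    (hiff : ∀ᵐ ω ∂P, (ω ∈ S ↔ ω ∈ C ∨ ω ∈ S')) (hdisj : Disjoint C S') :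
    cexp P X C = ((∫ ω in S, X ω ∂P) - ∫ ω in S', X ω ∂P) / (prr P S - prr P S') := by
  have hae : S =ᵐ[P] (C ∪ S' : Set Ω) := by
    filter_upwards [hiff] with ω h using propext h
  have hI : ∫ ω in S, X ω ∂P = (∫ ω in C, X ω ∂P) + ∫ ω in S', X ω ∂P := by
    rw [setIntegral_congr_set hae, setIntegral_union hdisj hS' hX.integrableOn hX.integrableOn]
  have hp : prr P S = prr P C + prr P S' := by
    simp only [prr]
    rw [measure_congr hae, measure_union hdisj hS', ENNReal.toReal_add (by simp) (by simp)]
  rw [hI, hp, add_sub_cancel_right, add_sub_cancel_right, cexp]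

/-- Proposition (identification in the 3×3 model under strict, one-to-one targeting):
eight counterfactual means are point-identified. -/
theorem statement12
    (P : Measure Ω) [IsProbabilityMeasure P]
    (T : Fin 3 → Ω → Fin 3) (Z : Ω → Fin 3) (Y : Fin 3 → Ω → ℝ)
    (U : Fin 3 → Fin 3 → ℝ) (u : Fin 3 → Ω → ℝ)
    (hTmeas : ∀ z, Measurable (T z)) (hZmeas : Measurable Z)
    (hYmeas : ∀ t, Measurable (Y t)) (hYint : ∀ t, Integrable (Y t) P)
    (humeas : ∀ t, Measurable (u t))
    (hZpos : ∀ z, 0 < P {ω | Z ω = z})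
    (hindep : IndepFun Z
      (fun ω => ((fun z => T z ω), (fun t => Y t ω), (fun t => u t ω))) P)
    (hmax : ∀ᵐ ω ∂P, ∀ z t, t ≠ T z ω →
      U z t + u t ω < U z (T z ω) + u (T z ω) ω)
    (hΔ11 : U 0 1 - U 0 0 < U 1 1 - U 1 0)
    (hΔ21 : U 0 1 - U 0 0 = U 2 1 - U 2 0)
    (hΔ22 : U 0 2 - U 0 0 < U 2 2 - U 2 0)
    (hΔ12 : U 0 2 - U 0 0 = U 1 2 - U 1 0)
    -- the eight response groups have positive probability
    (hA0 : 0 < P (grp3 T 0 0 0)) (hA1 : 0 < P (grp3 T 1 1 1)) (hA2 : 0 < P (grp3 T 2 2 2))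
    (hC010 : 0 < P (grp3 T 0 1 0)) (hC002 : 0 < P (grp3 T 0 0 2))
    (hC012 : 0 < P (grp3 T 0 1 2)) (hC112 : 0 < P (grp3 T 1 1 2))
    (hC212 : 0 < P (grp3 T 2 1 2))
    -- nonzero denominators
    (hd1 : pscore P (fun ω => T (Z ω) ω) Z 1 2 ≠ 0)
    (hd2 : pscore P (fun ω => T (Z ω) ω) Z 2 1 ≠ 0)
    (hd3 : pscore P (fun ω => T (Z ω) ω) Z 0 0 - pscore P (fun ω => T (Z ω) ω) Z 0 1 ≠ 0)
    (hd4 : pscore P (fun ω => T (Z ω) ω) Z 0 0 - pscore P (fun ω => T (Z ω) ω) Z 0 2 ≠ 0)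
    (hd5 : pscore P (fun ω => T (Z ω) ω) Z 1 1 - pscore P (fun ω => T (Z ω) ω) Z 1 0 ≠ 0)
    (hd6 : pscore P (fun ω => T (Z ω) ω) Z 1 0 - pscore P (fun ω => T (Z ω) ω) Z 1 2 ≠ 0)
    (hd7 : pscore P (fun ω => T (Z ω) ω) Z 2 2 - pscore P (fun ω => T (Z ω) ω) Z 2 0 ≠ 0)
    (hd8 : pscore P (fun ω => T (Z ω) ω) Z 2 0 - pscore P (fun ω => T (Z ω) ω) Z 2 1 ≠ 0) :
    cexp P (Y 1) (grp3 T 1 1 1)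
        = ebar P (fun ω => T (Z ω) ω) Z (fun ω => Y (T (Z ω) ω) ω) 2 1
          / pscore P (fun ω => T (Z ω) ω) Z 1 2
    ∧ cexp P (Y 2) (grp3 T 2 2 2)
        = ebar P (fun ω => T (Z ω) ω) Z (fun ω => Y (T (Z ω) ω) ω) 1 2
          / pscore P (fun ω => T (Z ω) ω) Z 2 1
    ∧ cexp P (Y 0) (grp3 T 0 1 0 ∪ grp3 T 0 1 2)
        = (ebar P (fun ω => T (Z ω) ω) Z (fun ω => Y (T (Z ω) ω) ω) 0 0
            - ebar P (fun ω => T (Z ω) ω) Z (fun ω => Y (T (Z ω) ω) ω) 1 0)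
          / (pscore P (fun ω => T (Z ω) ω) Z 0 0 - pscore P (fun ω => T (Z ω) ω) Z 0 1)
    ∧ cexp P (Y 0) (grp3 T 0 0 2 ∪ grp3 T 0 1 2)
        = (ebar P (fun ω => T (Z ω) ω) Z (fun ω => Y (T (Z ω) ω) ω) 0 0
            - ebar P (fun ω => T (Z ω) ω) Z (fun ω => Y (T (Z ω) ω) ω) 2 0)
          / (pscore P (fun ω => T (Z ω) ω) Z 0 0 - pscore P (fun ω => T (Z ω) ω) Z 0 2)
    ∧ cexp P (Y 1) (grp3 T 0 1 0 ∪ grp3 T 0 1 2 ∪ grp3 T 2 1 2)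
        = (ebar P (fun ω => T (Z ω) ω) Z (fun ω => Y (T (Z ω) ω) ω) 1 1
            - ebar P (fun ω => T (Z ω) ω) Z (fun ω => Y (T (Z ω) ω) ω) 0 1)
          / (pscore P (fun ω => T (Z ω) ω) Z 1 1 - pscore P (fun ω => T (Z ω) ω) Z 1 0)
    ∧ cexp P (Y 1) (grp3 T 1 1 2)
        = (ebar P (fun ω => T (Z ω) ω) Z (fun ω => Y (T (Z ω) ω) ω) 0 1
            - ebar P (fun ω => T (Z ω) ω) Z (fun ω => Y (T (Z ω) ω) ω) 2 1)
          / (pscore P (fun ω => T (Z ω) ω) Z 1 0 - pscore P (fun ω => T (Z ω) ω) Z 1 2)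
    ∧ cexp P (Y 2) (grp3 T 0 0 2 ∪ grp3 T 0 1 2 ∪ grp3 T 1 1 2)
        = (ebar P (fun ω => T (Z ω) ω) Z (fun ω => Y (T (Z ω) ω) ω) 2 2
            - ebar P (fun ω => T (Z ω) ω) Z (fun ω => Y (T (Z ω) ω) ω) 0 2)
          / (pscore P (fun ω => T (Z ω) ω) Z 2 2 - pscore P (fun ω => T (Z ω) ω) Z 2 0)
    ∧ cexp P (Y 2) (grp3 T 2 1 2)
        = (ebar P (fun ω => T (Z ω) ω) Z (fun ω => Y (T (Z ω) ω) ω) 0 2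
            - ebar P (fun ω => T (Z ω) ω) Z (fun ω => Y (T (Z ω) ω) ω) 1 2)
          / (pscore P (fun ω => T (Z ω) ω) Z 2 0 - pscore P (fun ω => T (Z ω) ω) Z 2 1) := by
  have hWmeas : Measurable
      (fun ω => ((fun z => T z ω), (fun t => Y t ω), (fun t => u t ω)) :
        Ω → (Fin 3 → Fin 3) × (Fin 3 → ℝ) × (Fin 3 → ℝ)) :=
    (measurable_pi_lambda _ hTmeas).prodMk
      ((measurable_pi_lambda _ hYmeas).prodMk (measurable_pi_lambda _ humeas))
  have hTset : ∀ z t, MeasurableSet {ω | T z ω = t} := fun z t =>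
    hTmeas z (measurableSet_singleton t)
  have hset : ∀ z t, {ω | T (Z ω) ω = t} ∩ {ω | Z ω = z} = {ω | T z ω = t} ∩ {ω | Z ω = z} := by
    intro z t
    ext ω
    simp only [Set.mem_inter_iff, Set.mem_ofPred_eq]
    constructor <;> rintro ⟨h, rfl⟩ <;> exact ⟨h, rfl⟩
  have hZne : ∀ z, prr P {ω | Z ω = z} ≠ 0 := fun z =>
    (ENNReal.toReal_pos (hZpos z).ne' (measure_ne_top _ _)).ne'
  have hfactor : ∀ z t (g : (Fin 3 → Fin 3) × (Fin 3 → ℝ) × (Fin 3 → ℝ) → ℝ), Measurable g →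
      ∫ ω in {ω | T z ω = t} ∩ {ω | Z ω = z}, g (fun z => T z ω, fun t => Y t ω, fun t => u t ω) ∂P
        = prr P {ω | Z ω = z} *
          ∫ ω in {ω | T z ω = t}, g (fun z => T z ω, fun t => Y t ω, fun t => u t ω) ∂P :=
    fun z t g hg => setIntegral_inter_of_indepFun hZmeas hWmeas hindep
      (measurableSet_singleton z) (B := (fun w => w.1 z) ⁻¹' {t})
      ((measurable_pi_apply z).comp measurable_fst (measurableSet_singleton t)) hg
  have hps : ∀ z t, pscore P (fun ω => T (Z ω) ω) Z t z = prr P {ω | T z ω = t} := by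
    intro z t
    have h := hfactor z t (fun _ => 1) measurable_const
    simp only [setIntegral_const, smul_eq_mul, mul_one] at h
    rw [pscore, hset, div_eq_iff (hZne z), mul_comm]
    exact h
  have heb : ∀ z t, ebar P (fun ω => T (Z ω) ω) Z (fun ω => Y (T (Z ω) ω) ω) z t
      = ∫ ω in {ω | T z ω = t}, Y t ω ∂P := by
    intro z t
    have hY : ∫ ω in {ω | T z ω = t} ∩ {ω | Z ω = z}, Y (T (Z ω) ω) ω ∂P
        = ∫ ω in {ω | T z ω = t} ∩ {ω | Z ω = z}, Y t ω ∂P := by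
      refine setIntegral_congr_fun ((hTset z t).inter (hZmeas (measurableSet_singleton z))) ?_
      rintro ω ⟨h, hz⟩
      simp only [Set.mem_ofPred_eq] at h hz
      simp only [hz, h]
    rw [ebar, hset, hY, div_eq_iff (hZne z), mul_comm]
    exact hfactor z t (fun w => w.2.1 t) (by fun_prop)
  have htypes := hmax.mono fun ω h =>
    arum_response_types U (fun t => u t ω) (fun z => T z ω) h hΔ11 hΔ21 hΔ22 hΔ12
  simp only [hps, heb]
  refine ⟨?_, ?_, ?_, ?_, ?_, ?_, ?_, ?_⟩
  · simpa [prr] using cexp_eq_wald (hYint 1) MeasurableSet.empty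
      (S := {ω | T 2 ω = 1})
      (htypes.mono fun ω h => by simp only [grp3, Set.mem_ofPred_eq, Set.mem_empty_iff_false]; grind)
      (Set.disjoint_empty _)
  · simpa [prr] using cexp_eq_wald (hYint 2) MeasurableSet.empty
      (S := {ω | T 1 ω = 2})
      (htypes.mono fun ω h => by simp only [grp3, Set.mem_ofPred_eq, Set.mem_empty_iff_false]; grind)
      (Set.disjoint_empty _)
  all_goals
    refine cexp_eq_wald (hYint _) (hTset _ _)
      (htypes.mono fun ω h => ?_) (Set.disjoint_left.2 fun ω h h' => ?_)
    · simp only [grp3, Set.mem_ofPred_eq, Set.mem_union]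
      grind
    · simp only [grp3, Set.mem_ofPred_eq, Set.mem_union] at h h'
      grind
end
end

section
/- In the 3×3 ARUM with strict one-to-one targeting (with all eight response groups of positive probability and nonzero denominators): (a) if E[Y(1) | C_{112}] = E[Y(1) | C_{212}], then E[Y(1) − Y(0) | C_{010} ∪ C_{012}] = [ (Ē_1(1) − Ē_0(1)) − ((Ē_0(1) − Ē_2(1)) / (P(1|0) − P(1|2))) · (P(2|0) − P(2|1)) − (Ē_0(0) − Ē_1(0)) ] / (P(0|0) − P(0|1)); (b) if E[Y(2) | C_{112}] = E[Y(2) | C_{212}], then E[Y(2) − Y(0) | C_{002} ∪ C_{012}] = [ (Ē_2(2) − Ē_0(2)) − ((Ē_0(2) − Ē_1(2)) / (P(2|0) − P(2|1))) · (P(1|0) − P(1|2)) − (Ē_0(0) − Ē_2(0)) ] / (P(0|0) − P(0|2)); (c) if both homogeneity conditions hold, then E[Y(1) − Y(2) | C_{112} ∪ C_{212}] = (Ē_0(1) − Ē_2(1)) / (P(1|0) − P(1|2)) − (Ē_0(2) − Ē_1(2)) / (P(2|0) − P(2|1)). -/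
open MeasureTheory ProbabilityTheory

noncomputable section

variable {Ω : Type*} [MeasurableSpace Ω]

/-- The integral of `X` over an event about `D`, intersected with an independent event about `Z`,
factorizes. -/
theorem setIntegral_inter_eq_mul_of_indepFun {Ω 𝒟 𝒵 : Type*} [MeasurableSpace Ω]
    [MeasurableSpace 𝒟] [MeasurableSingletonClass 𝒟]
    [MeasurableSpace 𝒵] [MeasurableSingletonClass 𝒵]
    {P : Measure Ω} {D : Ω → 𝒟} {Z : Ω → 𝒵} {X : Ω → ℝ}
    (hD : Measurable D) (hZ : Measurable Z) (hX : Measurable X)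
    (hind : IndepFun Z (fun ω => (D ω, X ω)) P) (d : 𝒟) (z : 𝒵) :
    ∫ ω in {ω | D ω = d} ∩ {ω | Z ω = z}, X ω ∂P
      = prr P {ω | Z ω = z} * ∫ ω in {ω | D ω = d}, X ω ∂P := by
  have hDm : MeasurableSet {ω | D ω = d} := hD (measurableSet_singleton d)
  have hZm : MeasurableSet {ω | Z ω = z} := hZ (measurableSet_singleton z)
  have hφ : Measurable (({z} : Set 𝒵).indicator (fun _ => (1 : ℝ))) :=
    measurable_const.indicator (measurableSet_singleton z)
  have hψ : Measurable ((Prod.fst ⁻¹' ({d} : Set 𝒟)).indicator (fun p : 𝒟 × ℝ => p.2)) :=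
    measurable_snd.indicator (measurable_fst (measurableSet_singleton d))
  have key := (hind.comp hφ hψ).integral_mul_eq_mul_integral
    (hφ.comp hZ).aestronglyMeasurable (hψ.comp (hD.prodMk hX)).aestronglyMeasurable
  have h1 : ({z} : Set 𝒵).indicator (fun _ => (1 : ℝ)) ∘ Z
      = {ω | Z ω = z}.indicator (fun _ => (1 : ℝ)) := by
    rfl
  have h2 : (Prod.fst ⁻¹' ({d} : Set 𝒟)).indicator (fun p : 𝒟 × ℝ => p.2)
      ∘ (fun ω => (D ω, X ω)) = {ω | D ω = d}.indicator X := by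
    rfl
  have h3 : {ω | Z ω = z}.indicator (fun _ => (1 : ℝ)) * {ω | D ω = d}.indicator X
      = ({ω | D ω = d} ∩ {ω | Z ω = z}).indicator X := by
    ext ω
    by_cases hd : D ω = d <;> by_cases hz : Z ω = z <;> simp [hd, hz]
  rw [h1, h2, h3, integral_indicator (hDm.inter hZm), integral_indicator hDm,
    integral_indicator hZm] at key
  rw [key]
  simp [prr, Measure.real]

theorem prr_eq_setIntegral_one {Ω : Type*} [MeasurableSpace Ω] (P : Measure Ω) (A : Set Ω) :
    prr P A = ∫ _ in A, (1 : ℝ) ∂P := by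
  simp [prr, Measure.real]

theorem setIntegral_eq_add_of_ae {Ω : Type*} [MeasurableSpace Ω] {P : Measure Ω}
    {A B C : Set Ω} {X : Ω → ℝ} (hX : Integrable X P) (hC : MeasurableSet C)
    (hdisj : Disjoint B C) (hA : ∀ᵐ ω ∂P, ω ∈ A ↔ ω ∈ B ∪ C) :
    ∫ ω in A, X ω ∂P = ∫ ω in B, X ω ∂P + ∫ ω in C, X ω ∂P := by
  rw [setIntegral_congr_set (Filter.eventuallyEq_set.2 hA),
    setIntegral_union hdisj hC hX.integrableOn hX.integrableOn]

theorem div_mul_of_div_eq_div {a b p q : ℝ} (hq : q ≠ 0)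
    (h : a / p = b / q) : a / p * q = b := by
  rw [h]; field_simp

/-- The monotonicity pattern of treatment choices under strict one-to-one targeting. -/
def Targeted (a b c : Fin 3) : Prop :=
  (b = a ∨ b = 1) ∧ (c = a ∨ c = 2) ∧ (a = 1 → b = 1) ∧ (a = 2 → c = 2)

instance (a b c : Fin 3) : Decidable (Targeted a b c) := by unfold Targeted; infer_instance

/-- An almost sure decomposition of an event about the response group, checked on the response
groups compatible with targeting, decomposes set integrals. -/
theorem setIntegral_eq_add_of_targeted {Ω : Type*} [MeasurableSpace Ω] {P : Measure Ω}
    {T : Fin 3 → Ω → Fin 3} (hT : ∀ z, Measurable (T z))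
    (htarget : ∀ᵐ ω ∂P, Targeted (T 0 ω) (T 1 ω) (T 2 ω))
    {X : Ω → ℝ} (hX : Integrable X P) (p q r : Fin 3 → Fin 3 → Fin 3 → Prop)
    (hdisj : ∀ a b c, ¬ (q a b c ∧ r a b c))
    (hdec : ∀ a b c, Targeted a b c → (p a b c ↔ q a b c ∨ r a b c)) :
    ∫ ω in {ω | p (T 0 ω) (T 1 ω) (T 2 ω)}, X ω ∂P
      = ∫ ω in {ω | q (T 0 ω) (T 1 ω) (T 2 ω)}, X ω ∂P
        + ∫ ω in {ω | r (T 0 ω) (T 1 ω) (T 2 ω)}, X ω ∂P := by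
  have hr : MeasurableSet {ω | r (T 0 ω) (T 1 ω) (T 2 ω)} :=
    ((hT 0).prodMk ((hT 1).prodMk (hT 2)))
      (MeasurableSet.of_discrete (s := {x : Fin 3 × Fin 3 × Fin 3 | r x.1 x.2.1 x.2.2}))
  refine setIntegral_eq_add_of_ae hX hr
    (Set.disjoint_left.2 fun ω h h' => hdisj _ _ _ ⟨h, h'⟩) ?_
  filter_upwards [htarget] with ω h using hdec _ _ _ h

/-- Corollary (point-identifying treatment effects in the 3×3 model): under the
homogeneity assumptions, three local average treatment effects are point-identified. -/
theorem statement13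
    (P : Measure Ω) [IsProbabilityMeasure P]
    (T : Fin 3 → Ω → Fin 3) (Z : Ω → Fin 3) (Y : Fin 3 → Ω → ℝ)
    (U : Fin 3 → Fin 3 → ℝ) (u : Fin 3 → Ω → ℝ)
    (hTmeas : ∀ z, Measurable (T z)) (hZmeas : Measurable Z)
    (hYmeas : ∀ t, Measurable (Y t)) (hYint : ∀ t, Integrable (Y t) P)
    (humeas : ∀ t, Measurable (u t))
    (hZpos : ∀ z, 0 < P {ω | Z ω = z})
    (hindep : IndepFun Z
      (fun ω => ((fun z => T z ω), (fun t => Y t ω), (fun t => u t ω))) P)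
    (hmax : ∀ᵐ ω ∂P, ∀ z t, t ≠ T z ω →
      U z t + u t ω < U z (T z ω) + u (T z ω) ω)
    (hΔ11 : U 0 1 - U 0 0 < U 1 1 - U 1 0)
    (hΔ21 : U 0 1 - U 0 0 = U 2 1 - U 2 0)
    (hΔ22 : U 0 2 - U 0 0 < U 2 2 - U 2 0)
    (hΔ12 : U 0 2 - U 0 0 = U 1 2 - U 1 0)
    -- the eight response groups have positive probability
    (hA0 : 0 < P (grp3 T 0 0 0)) (hA1 : 0 < P (grp3 T 1 1 1)) (hA2 : 0 < P (grp3 T 2 2 2))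
    (hC010 : 0 < P (grp3 T 0 1 0)) (hC002 : 0 < P (grp3 T 0 0 2))
    (hC012 : 0 < P (grp3 T 0 1 2)) (hC112 : 0 < P (grp3 T 1 1 2))
    (hC212 : 0 < P (grp3 T 2 1 2))
    -- nonzero denominators
    (hd3 : pscore P (fun ω => T (Z ω) ω) Z 0 0 - pscore P (fun ω => T (Z ω) ω) Z 0 1 ≠ 0)
    (hd4 : pscore P (fun ω => T (Z ω) ω) Z 0 0 - pscore P (fun ω => T (Z ω) ω) Z 0 2 ≠ 0)
    (hd6 : pscore P (fun ω => T (Z ω) ω) Z 1 0 - pscore P (fun ω => T (Z ω) ω) Z 1 2 ≠ 0)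
    (hd8 : pscore P (fun ω => T (Z ω) ω) Z 2 0 - pscore P (fun ω => T (Z ω) ω) Z 2 1 ≠ 0) :
    -- (a)
    (cexp P (Y 1) (grp3 T 1 1 2) = cexp P (Y 1) (grp3 T 2 1 2) →
      cexp P (fun ω => Y 1 ω - Y 0 ω) (grp3 T 0 1 0 ∪ grp3 T 0 1 2)
        = ((ebar P (fun ω => T (Z ω) ω) Z (fun ω => Y (T (Z ω) ω) ω) 1 1
              - ebar P (fun ω => T (Z ω) ω) Z (fun ω => Y (T (Z ω) ω) ω) 0 1)
            - ((ebar P (fun ω => T (Z ω) ω) Z (fun ω => Y (T (Z ω) ω) ω) 0 1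
                  - ebar P (fun ω => T (Z ω) ω) Z (fun ω => Y (T (Z ω) ω) ω) 2 1)
                / (pscore P (fun ω => T (Z ω) ω) Z 1 0
                    - pscore P (fun ω => T (Z ω) ω) Z 1 2))
              * (pscore P (fun ω => T (Z ω) ω) Z 2 0
                  - pscore P (fun ω => T (Z ω) ω) Z 2 1)
            - (ebar P (fun ω => T (Z ω) ω) Z (fun ω => Y (T (Z ω) ω) ω) 0 0
                - ebar P (fun ω => T (Z ω) ω) Z (fun ω => Y (T (Z ω) ω) ω) 1 0))
          / (pscore P (fun ω => T (Z ω) ω) Z 0 0 - pscore P (fun ω => T (Z ω) ω) Z 0 1))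
    -- (b)
    ∧ (cexp P (Y 2) (grp3 T 1 1 2) = cexp P (Y 2) (grp3 T 2 1 2) →
      cexp P (fun ω => Y 2 ω - Y 0 ω) (grp3 T 0 0 2 ∪ grp3 T 0 1 2)
        = ((ebar P (fun ω => T (Z ω) ω) Z (fun ω => Y (T (Z ω) ω) ω) 2 2
              - ebar P (fun ω => T (Z ω) ω) Z (fun ω => Y (T (Z ω) ω) ω) 0 2)
            - ((ebar P (fun ω => T (Z ω) ω) Z (fun ω => Y (T (Z ω) ω) ω) 0 2
                  - ebar P (fun ω => T (Z ω) ω) Z (fun ω => Y (T (Z ω) ω) ω) 1 2)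
                / (pscore P (fun ω => T (Z ω) ω) Z 2 0
                    - pscore P (fun ω => T (Z ω) ω) Z 2 1))
              * (pscore P (fun ω => T (Z ω) ω) Z 1 0
                  - pscore P (fun ω => T (Z ω) ω) Z 1 2)
            - (ebar P (fun ω => T (Z ω) ω) Z (fun ω => Y (T (Z ω) ω) ω) 0 0
                - ebar P (fun ω => T (Z ω) ω) Z (fun ω => Y (T (Z ω) ω) ω) 2 0))
          / (pscore P (fun ω => T (Z ω) ω) Z 0 0 - pscore P (fun ω => T (Z ω) ω) Z 0 2))
    -- (c)
    ∧ (cexp P (Y 1) (grp3 T 1 1 2) = cexp P (Y 1) (grp3 T 2 1 2) →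
       cexp P (Y 2) (grp3 T 1 1 2) = cexp P (Y 2) (grp3 T 2 1 2) →
      cexp P (fun ω => Y 1 ω - Y 2 ω) (grp3 T 1 1 2 ∪ grp3 T 2 1 2)
        = (ebar P (fun ω => T (Z ω) ω) Z (fun ω => Y (T (Z ω) ω) ω) 0 1
            - ebar P (fun ω => T (Z ω) ω) Z (fun ω => Y (T (Z ω) ω) ω) 2 1)
          / (pscore P (fun ω => T (Z ω) ω) Z 1 0 - pscore P (fun ω => T (Z ω) ω) Z 1 2)
        - (ebar P (fun ω => T (Z ω) ω) Z (fun ω => Y (T (Z ω) ω) ω) 0 2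
            - ebar P (fun ω => T (Z ω) ω) Z (fun ω => Y (T (Z ω) ω) ω) 1 2)
          / (pscore P (fun ω => T (Z ω) ω) Z 2 0 - pscore P (fun ω => T (Z ω) ω) Z 2 1)) := by
  have htarget : ∀ᵐ ω ∂P, Targeted (T 0 ω) (T 1 ω) (T 2 ω) := by
    filter_upwards [hmax] with ω h
    have h0 := h 0
    have h1 := h 1
    have h2 := h 2
    clear h
    generalize T 0 ω = a at *
    generalize T 1 ω = b at *
    generalize T 2 ω = c at *
    unfold Targeted
    refine ⟨?_, ?_, ?_, ?_⟩
    · by_contra! hne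
      have e0 := h0 b hne.1
      have e1 := h1 a hne.1.symm
      fin_cases a <;> fin_cases b <;> simp at * <;> linarith
    · by_contra! hne
      have e0 := h0 c hne.1
      have e2 := h2 a hne.1.symm
      fin_cases a <;> fin_cases c <;> simp at * <;> linarith
    · rintro rfl
      by_contra! hne
      have e0 := h0 b hne
      have e1 := h1 1 hne.symm
      fin_cases b <;> simp at * <;> linarith
    · rintro rfl
      by_contra! hne
      have e0 := h0 c hne
      have e2 := h2 2 hne.symm
      fin_cases c <;> simp at * <;> linarith
  have hZ0 : ∀ z, prr P {ω | Z ω = z} ≠ 0 := fun z =>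
    (ENNReal.toReal_pos (hZpos z).ne' (measure_ne_top _ _)).ne'
  have hset : ∀ z t,
      {ω | T (Z ω) ω = t} ∩ {ω | Z ω = z} = {ω | T z ω = t} ∩ {ω | Z ω = z} := by
    intro z t
    ext ω
    simp only [Set.mem_inter_iff, Set.mem_ofPred_eq]
    constructor <;> rintro ⟨h, rfl⟩ <;> exact ⟨h, rfl⟩
  have hebar : ∀ z t, ebar P (fun ω => T (Z ω) ω) Z (fun ω => Y (T (Z ω) ω) ω) z t
      = ∫ ω in {ω | T z ω = t}, Y t ω ∂P := by
    intro z t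
    have hm : MeasurableSet ({ω | T z ω = t} ∩ {ω | Z ω = z}) :=
      (hTmeas z (measurableSet_singleton t)).inter (hZmeas (measurableSet_singleton z))
    have hind : IndepFun Z (fun ω => (T z ω, Y t ω)) P :=
      hindep.comp measurable_id
        (ψ := fun p : (Fin 3 → Fin 3) × (Fin 3 → ℝ) × (Fin 3 → ℝ) => (p.1 z, p.2.1 t))
        (by fun_prop)
    have hcongr : ∫ ω in {ω | T z ω = t} ∩ {ω | Z ω = z}, Y (T (Z ω) ω) ω ∂P
        = ∫ ω in {ω | T z ω = t} ∩ {ω | Z ω = z}, Y t ω ∂P := by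
      refine setIntegral_congr_fun hm ?_
      rintro ω ⟨h, rfl⟩
      simp only [Set.mem_ofPred_eq] at h
      simp only [h]
    rw [ebar, hset z t, hcongr,
      setIntegral_inter_eq_mul_of_indepFun (hTmeas z) hZmeas (hYmeas t) hind,
      mul_div_cancel_left₀ _ (hZ0 z)]
  have hpscore : ∀ z t, pscore P (fun ω => T (Z ω) ω) Z t z
      = ∫ _ in {ω | T z ω = t}, (1 : ℝ) ∂P := by
    intro z t
    have hind : IndepFun Z (fun ω => (T z ω, (1 : ℝ))) P :=
      hindep.comp measurable_id
        (ψ := fun p : (Fin 3 → Fin 3) × (Fin 3 → ℝ) × (Fin 3 → ℝ) => (p.1 z, (1 : ℝ)))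
        (by fun_prop)
    rw [pscore, hset z t, prr_eq_setIntegral_one P (_ ∩ _),
      setIntegral_inter_eq_mul_of_indepFun (hTmeas z) hZmeas measurable_const hind,
      mul_div_cancel_left₀ _ (hZ0 z)]
  have e00_10 : ∀ {X : Ω → ℝ}, Integrable X P →
      ∫ ω in {ω | T 0 ω = 0}, X ω ∂P
        = ∫ ω in {ω | T 1 ω = 0}, X ω ∂P
          + ∫ ω in (grp3 T 0 1 0 ∪ grp3 T 0 1 2), X ω ∂P := fun hX =>
    setIntegral_eq_add_of_targeted hTmeas htarget hX
      (fun a b c => a = 0) (fun a b c => b = 0)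
      (fun a b c => (a = 0 ∧ b = 1 ∧ c = 0) ∨ (a = 0 ∧ b = 1 ∧ c = 2))
      (by decide) (by decide)
  have e01_21 : ∀ {X : Ω → ℝ}, Integrable X P →
      ∫ ω in {ω | T 0 ω = 1}, X ω ∂P
        = ∫ ω in {ω | T 2 ω = 1}, X ω ∂P
          + ∫ ω in (grp3 T 1 1 2), X ω ∂P := fun hX =>
    setIntegral_eq_add_of_targeted hTmeas htarget hX
      (fun a b c => a = 1) (fun a b c => c = 1)
      (fun a b c => (a = 1 ∧ b = 1 ∧ c = 2))
      (by decide) (by decide)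
  have e02_12 : ∀ {X : Ω → ℝ}, Integrable X P →
      ∫ ω in {ω | T 0 ω = 2}, X ω ∂P
        = ∫ ω in {ω | T 1 ω = 2}, X ω ∂P
          + ∫ ω in (grp3 T 2 1 2), X ω ∂P := fun hX =>
    setIntegral_eq_add_of_targeted hTmeas htarget hX
      (fun a b c => a = 2) (fun a b c => b = 2)
      (fun a b c => (a = 2 ∧ b = 1 ∧ c = 2))
      (by decide) (by decide)
  have e00_20 : ∀ {X : Ω → ℝ}, Integrable X P →
      ∫ ω in {ω | T 0 ω = 0}, X ω ∂P
        = ∫ ω in {ω | T 2 ω = 0}, X ω ∂P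
          + ∫ ω in (grp3 T 0 0 2 ∪ grp3 T 0 1 2), X ω ∂P := fun hX =>
    setIntegral_eq_add_of_targeted hTmeas htarget hX
      (fun a b c => a = 0) (fun a b c => c = 0)
      (fun a b c => (a = 0 ∧ b = 0 ∧ c = 2) ∨ (a = 0 ∧ b = 1 ∧ c = 2))
      (by decide) (by decide)
  have e11_01 : ∀ {X : Ω → ℝ}, Integrable X P →
      ∫ ω in {ω | T 1 ω = 1}, X ω ∂P
        = ∫ ω in {ω | T 0 ω = 1}, X ω ∂P
          + ∫ ω in ((grp3 T 0 1 0 ∪ grp3 T 0 1 2) ∪ grp3 T 2 1 2), X ω ∂P := fun hX =>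
    setIntegral_eq_add_of_targeted hTmeas htarget hX
      (fun a b c => b = 1) (fun a b c => a = 1)
      (fun a b c => ((a = 0 ∧ b = 1 ∧ c = 0) ∨ (a = 0 ∧ b = 1 ∧ c = 2))
        ∨ (a = 2 ∧ b = 1 ∧ c = 2))
      (by decide) (by decide)
  have e22_02 : ∀ {X : Ω → ℝ}, Integrable X P →
      ∫ ω in {ω | T 2 ω = 2}, X ω ∂P
        = ∫ ω in {ω | T 0 ω = 2}, X ω ∂P
          + ∫ ω in ((grp3 T 0 0 2 ∪ grp3 T 0 1 2) ∪ grp3 T 1 1 2), X ω ∂P := fun hX =>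
    setIntegral_eq_add_of_targeted hTmeas htarget hX
      (fun a b c => c = 2) (fun a b c => a = 2)
      (fun a b c => ((a = 0 ∧ b = 0 ∧ c = 2) ∨ (a = 0 ∧ b = 1 ∧ c = 2))
        ∨ (a = 1 ∧ b = 1 ∧ c = 2))
      (by decide) (by decide)
  have eU1 : ∀ {X : Ω → ℝ}, Integrable X P →
      ∫ ω in ((grp3 T 0 1 0 ∪ grp3 T 0 1 2) ∪ grp3 T 2 1 2), X ω ∂P
        = ∫ ω in (grp3 T 0 1 0 ∪ grp3 T 0 1 2), X ω ∂P
          + ∫ ω in (grp3 T 2 1 2), X ω ∂P := fun hX =>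
    setIntegral_eq_add_of_targeted hTmeas htarget hX
      (fun a b c => ((a = 0 ∧ b = 1 ∧ c = 0) ∨ (a = 0 ∧ b = 1 ∧ c = 2))
        ∨ (a = 2 ∧ b = 1 ∧ c = 2))
      (fun a b c => (a = 0 ∧ b = 1 ∧ c = 0) ∨ (a = 0 ∧ b = 1 ∧ c = 2))
      (fun a b c => (a = 2 ∧ b = 1 ∧ c = 2))
      (by decide) (by decide)
  have eU2 : ∀ {X : Ω → ℝ}, Integrable X P →
      ∫ ω in ((grp3 T 0 0 2 ∪ grp3 T 0 1 2) ∪ grp3 T 1 1 2), X ω ∂P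
        = ∫ ω in (grp3 T 0 0 2 ∪ grp3 T 0 1 2), X ω ∂P
          + ∫ ω in (grp3 T 1 1 2), X ω ∂P := fun hX =>
    setIntegral_eq_add_of_targeted hTmeas htarget hX
      (fun a b c => ((a = 0 ∧ b = 0 ∧ c = 2) ∨ (a = 0 ∧ b = 1 ∧ c = 2))
        ∨ (a = 1 ∧ b = 1 ∧ c = 2))
      (fun a b c => (a = 0 ∧ b = 0 ∧ c = 2) ∨ (a = 0 ∧ b = 1 ∧ c = 2))
      (fun a b c => (a = 1 ∧ b = 1 ∧ c = 2))
      (by decide) (by decide)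
  have eU3 : ∀ {X : Ω → ℝ}, Integrable X P →
      ∫ ω in (grp3 T 1 1 2 ∪ grp3 T 2 1 2), X ω ∂P
        = ∫ ω in (grp3 T 1 1 2), X ω ∂P
          + ∫ ω in (grp3 T 2 1 2), X ω ∂P := fun hX =>
    setIntegral_eq_add_of_targeted hTmeas htarget hX
      (fun a b c => (a = 1 ∧ b = 1 ∧ c = 2) ∨ (a = 2 ∧ b = 1 ∧ c = 2))
      (fun a b c => (a = 1 ∧ b = 1 ∧ c = 2))
      (fun a b c => (a = 2 ∧ b = 1 ∧ c = 2))
      (by decide) (by decide)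
  have h1 : Integrable (fun _ : Ω => (1 : ℝ)) P := integrable_const 1
  have p112 : ∫ _ in grp3 T 1 1 2, (1 : ℝ) ∂P ≠ 0 := by
    rw [← prr_eq_setIntegral_one]
    exact (ENNReal.toReal_pos hC112.ne' (measure_ne_top _ _)).ne'
  have p212 : ∫ _ in grp3 T 2 1 2, (1 : ℝ) ∂P ≠ 0 := by
    rw [← prr_eq_setIntegral_one]
    exact (ENNReal.toReal_pos hC212.ne' (measure_ne_top _ _)).ne'
  have hsum : ∫ _ in grp3 T 1 1 2, (1 : ℝ) ∂P + ∫ _ in grp3 T 2 1 2, (1 : ℝ) ∂P ≠ 0 := by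
    rw [← prr_eq_setIntegral_one, ← prr_eq_setIntegral_one]
    exact (add_pos (ENNReal.toReal_pos hC112.ne' (measure_ne_top _ _))
      (ENNReal.toReal_pos hC212.ne' (measure_ne_top _ _))).ne'
  simp only [cexp, hebar, hpscore, prr_eq_setIntegral_one]
  refine ⟨fun ha => ?_, fun hb => ?_, fun ha hb => ?_⟩
  · rw [integral_sub (hYint 1).integrableOn (hYint 0).integrableOn, e11_01 (hYint 1),
      eU1 (hYint 1), e01_21 (hYint 1), e01_21 h1, e02_12 h1, e00_10 (hYint 0), e00_10 h1]
    simp only [add_sub_cancel_left]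
    rw [div_mul_of_div_eq_div p212 ha]
    ring
  · rw [integral_sub (hYint 2).integrableOn (hYint 0).integrableOn, e22_02 (hYint 2),
      eU2 (hYint 2), e02_12 (hYint 2), e01_21 h1, e02_12 h1, e00_20 (hYint 0), e00_20 h1]
    simp only [add_sub_cancel_left]
    rw [div_mul_of_div_eq_div p112 hb.symm]
    ring
  · rw [integral_sub (hYint 1).integrableOn (hYint 2).integrableOn, eU3 (hYint 1),
      eU3 (hYint 2), eU3 h1, e01_21 (hYint 1), e01_21 h1, e02_12 (hYint 2), e02_12 h1]
    simp only [add_sub_cancel_left]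
    have ha' := div_mul_of_div_eq_div p212 ha
    have hb' := div_mul_of_div_eq_div p112 hb.symm
    rw [div_eq_iff hsum, ← ha', ← hb']
    field_simp
end
end

section
/- In the 3×3 ARUM with strict one-to-one targeting, suppose the reals β₀, β₁, β₂ satisfy the moment conditions E[(Y − β₀ − β₁·1(T = 1) − β₂·1(T = 2)) · 1(Z = z)] = 0 for z = 0, 1, 2. Then (β₁, β₂) solves the 2×2 linear system: P(C_{010} ∪ C_{012} ∪ C_{212}) · β₁ − P(C_{212}) · β₂ = E[(Y(1) − Y(0)) · 1(C_{010} ∪ C_{012} ∪ C_{212})] − E[(Y(2) − Y(0)) · 1(C_{212})], and −P(C_{112}) · β₁ + P(C_{002} ∪ C_{012} ∪ C_{112}) · β₂ = E[(Y(2) − Y(0)) · 1(C_{002} ∪ C_{012} ∪ C_{112})] − E[(Y(1) − Y(0)) · 1(C_{112})]. -/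
open MeasureTheory ProbabilityTheory

noncomputable section

variable {Ω : Type*} [MeasurableSpace Ω]

/-- Under a shift of utilities from `U` to `V` that raises the relative utility of `s` only,
the maximizer either stays put or moves to `s`. -/
theorem maximizer_eq_or_eq_of_targeted {ι : Type*} {U V u : ι → ℝ} {a b s o : ι}
    (ha : ∀ t, t ≠ a → U t + u t < U a + u a)
    (hb : ∀ t, t ≠ b → V t + u t < V b + u b)
    (hs : U s - U o ≤ V s - V o) (hne : ∀ t, t ≠ s → U t - U o = V t - V o) :
    b = a ∨ b = s := by
  by_contra! h
  have h₁ := ha b h.1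
  have h₂ := hb a h.1.symm
  have h₃ := hne b h.2
  have h₄ : U a - U o ≤ V a - V o := by
    by_cases has : a = s
    · exact has ▸ hs
    · exact (hne a has).le
  linarith

theorem apply_eq_sum_ite {ι : Type*} [Fintype ι] [DecidableEq ι] (y : ι → ℝ) (i : ι) :
    y i = ∑ t, if i = t then y t else 0 := by
  simp

/-- Evaluating a finite family of integrable functions at a random index is integrable. -/
theorem integrable_apply_random_index {ι : Type*} [Fintype ι] [DecidableEq ι]
    [MeasurableSpace ι] [MeasurableSingletonClass ι] {P : Measure Ω} {D : Ω → ι}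
    {Y : ι → Ω → ℝ} (hD : Measurable D) (hY : ∀ t, Integrable (Y t) P) :
    Integrable (fun ω => Y (D ω) ω) P := by
  have h : (fun ω => Y (D ω) ω) = fun ω => ∑ t, (D ⁻¹' {t}).indicator (Y t) ω := by
    classical
    ext ω
    rw [apply_eq_sum_ite (fun t => Y t ω) (D ω)]
    simp [Set.indicator_apply]
  rw [h]
  exact integrable_finsetSum _ fun t _ => (hY t).indicator (hD (measurableSet_singleton t))

theorem measurable_apply_random_index {α ι : Type*} [MeasurableSpace α] [Fintype ι]
    [DecidableEq ι] [MeasurableSpace ι] [MeasurableSingletonClass ι] {D : α → ι}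
    {Y : ι → α → ℝ} (hD : Measurable D) (hY : ∀ t, Measurable (Y t)) :
    Measurable (fun x => Y (D x) x) := by
  simp_rw [fun x => apply_eq_sum_ite (fun t => Y t x) (D x)]
  exact Finset.measurable_sum _ fun t _ =>
    Measurable.ite (hD (measurableSet_singleton t)) (hY t) measurable_const

/-- If `X` is independent of `Z`, its integral over a non-null level set of `Z` vanishes only
if its expectation does. -/
theorem integral_eq_zero_of_setIntegral_level_eq_zero {𝒵 : Type*} [MeasurableSpace 𝒵]
    [MeasurableSingletonClass 𝒵] {P : Measure Ω} [IsProbabilityMeasure P] {Z : Ω → 𝒵}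
    {X : Ω → ℝ} {z : 𝒵} (hZ : Measurable Z) (hX : AEStronglyMeasurable X P)
    (hindep : IndepFun Z X P) (hz : 0 < P {ω | Z ω = z})
    (h : ∫ ω in {ω | Z ω = z}, X ω ∂P = 0) : ∫ ω, X ω ∂P = 0 := by
  have hset : MeasurableSet {ω | Z ω = z} := hZ (measurableSet_singleton z)
  have hφ : Measurable (({z} : Set 𝒵).indicator (1 : 𝒵 → ℝ)) :=
    measurable_one.indicator (measurableSet_singleton z)
  have hprod := (hindep.comp hφ measurable_id).integral_fun_mul_eq_mul_integral
    (hφ.comp hZ).aestronglyMeasurable hX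
  have hleft : ∀ ω, (({z} : Set 𝒵).indicator (1 : 𝒵 → ℝ) ∘ Z) ω =
      {ω | Z ω = z}.indicator (1 : Ω → ℝ) ω := fun ω => by
    classical simp only [Function.comp_apply, Set.indicator_apply, Set.mem_singleton_iff,
      Set.mem_ofPred_eq, Pi.one_apply]
  simp_rw [hleft, integral_indicator_one hset, Function.comp_apply, id_eq] at hprod
  have hmul : ∀ ω, {ω | Z ω = z}.indicator (1 : Ω → ℝ) ω * X ω =
      {ω | Z ω = z}.indicator X ω := fun ω => by
    classical simp [Set.indicator_apply]
  simp_rw [hmul, integral_indicator hset, h] at hprod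
  exact (mul_eq_zero.mp hprod.symm).resolve_left
    (ENNReal.toReal_pos hz.ne' (measure_ne_top _ _)).ne'

theorem integral_indicator_sub_const {P : Measure Ω} [IsFiniteMeasure P] {X : Ω → ℝ}
    {A : Set Ω} (hA : MeasurableSet A) (hX : Integrable X P) (c : ℝ) :
    ∫ ω, A.indicator (fun ω => X ω - c) ω ∂P = ∫ ω in A, X ω ∂P - prr P A * c := by
  rw [integral_indicator hA, integral_sub hX.integrableOn (integrable_const c)]
  simp [prr, Measure.real]

/-- Two equal expectations whose difference is supported on events `A` and `B`, on which it
equals `X - c` and `-(W - d)`, give a linear equation in `c` and `d`. -/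
theorem prr_mul_sub_eq_of_integral_eq {P : Measure Ω} [IsFiniteMeasure P]
    {R S X W : Ω → ℝ} {A B : Set Ω} {c d : ℝ} (hR : Integrable R P) (hS : Integrable S P)
    (hX : Integrable X P) (hW : Integrable W P) (hA : MeasurableSet A) (hB : MeasurableSet B)
    (heq : ∫ ω, R ω ∂P = ∫ ω, S ω ∂P)
    (hdiff : ∀ᵐ ω ∂P, R ω - S ω =
      A.indicator (fun ω => X ω - c) ω - B.indicator (fun ω => W ω - d) ω) :
    prr P A * c - prr P B * d = ∫ ω in A, X ω ∂P - ∫ ω in B, W ω ∂P := by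
  have h := integral_congr_ae hdiff
  have hXc : Integrable (fun ω => X ω - c) P := hX.sub (integrable_const c)
  have hWd : Integrable (fun ω => W ω - d) P := hW.sub (integrable_const d)
  rw [integral_sub hR hS, integral_sub (hXc.indicator hA) (hWd.indicator hB),
    integral_indicator_sub_const hA hX,
    integral_indicator_sub_const hB hW, heq] at h
  linarith

theorem measurableSet_grp3 {T : Fin 3 → Ω → Fin 3} (hT : ∀ z, Measurable (T z))
    (a b c : Fin 3) : MeasurableSet (grp3 T a b c) :=
  (hT 0 (measurableSet_singleton a)).inter
    ((hT 1 (measurableSet_singleton b)).inter (hT 2 (measurableSet_singleton c)))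

/-- Proposition (TSLS in the 3×3 model under strict, one-to-one targeting):
the TSLS coefficients `(β₁, β₂)` solve a 2×2 linear system in group probabilities and
group-weighted treatment effects. -/
theorem statement14
    (P : Measure Ω) [IsProbabilityMeasure P]
    (T : Fin 3 → Ω → Fin 3) (Z : Ω → Fin 3) (Y : Fin 3 → Ω → ℝ)
    (U : Fin 3 → Fin 3 → ℝ) (u : Fin 3 → Ω → ℝ)
    (hTmeas : ∀ z, Measurable (T z)) (hZmeas : Measurable Z)
    (hYmeas : ∀ t, Measurable (Y t)) (hYint : ∀ t, Integrable (Y t) P)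
    (humeas : ∀ t, Measurable (u t))
    (hZpos : ∀ z, 0 < P {ω | Z ω = z})
    (hindep : IndepFun Z
      (fun ω => ((fun z => T z ω), (fun t => Y t ω), (fun t => u t ω))) P)
    (hmax : ∀ᵐ ω ∂P, ∀ z t, t ≠ T z ω →
      U z t + u t ω < U z (T z ω) + u (T z ω) ω)
    (hΔ11 : U 0 1 - U 0 0 < U 1 1 - U 1 0)
    (hΔ21 : U 0 1 - U 0 0 = U 2 1 - U 2 0)
    (hΔ22 : U 0 2 - U 0 0 < U 2 2 - U 2 0)
    (hΔ12 : U 0 2 - U 0 0 = U 1 2 - U 1 0)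
    (β₀ β₁ β₂ : ℝ)
    -- TSLS moment conditions
    (hmom : ∀ z : Fin 3,
      ∫ ω in {ω | Z ω = z},
        (Y (T (Z ω) ω) ω - β₀
          - β₁ * (if T (Z ω) ω = 1 then (1 : ℝ) else 0)
          - β₂ * (if T (Z ω) ω = 2 then (1 : ℝ) else 0)) ∂P = 0) :
    prr P (grp3 T 0 1 0 ∪ grp3 T 0 1 2 ∪ grp3 T 2 1 2) * β₁
        - prr P (grp3 T 2 1 2) * β₂
      = (∫ ω in grp3 T 0 1 0 ∪ grp3 T 0 1 2 ∪ grp3 T 2 1 2, (Y 1 ω - Y 0 ω) ∂P)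
        - (∫ ω in grp3 T 2 1 2, (Y 2 ω - Y 0 ω) ∂P)
    ∧ - prr P (grp3 T 1 1 2) * β₁
        + prr P (grp3 T 0 0 2 ∪ grp3 T 0 1 2 ∪ grp3 T 1 1 2) * β₂
      = (∫ ω in grp3 T 0 0 2 ∪ grp3 T 0 1 2 ∪ grp3 T 1 1 2, (Y 2 ω - Y 0 ω) ∂P)
        - (∫ ω in grp3 T 1 1 2, (Y 1 ω - Y 0 ω) ∂P) := by
  set r : Fin 3 → ℝ → ℝ := fun t y => y - β₀ - β₁ * (if t = 1 then (1 : ℝ) else 0)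
    - β₂ * (if t = 2 then (1 : ℝ) else 0) with hr
  have hrmeas : ∀ t, Measurable (r t) := fun t => by fun_prop
  have hRint : ∀ z, Integrable (fun ω => r (T z ω) (Y (T z ω) ω)) P := fun z =>
    integrable_apply_random_index (Y := fun t ω => r t (Y t ω)) (hTmeas z) fun t =>
      (((hYint t).sub (integrable_const _)).sub (integrable_const _)).sub (integrable_const _)
  have hzero : ∀ z, ∫ ω, r (T z ω) (Y (T z ω) ω) ∂P = 0 := by
    intro z
    have hφ : Measurable (fun p : (Fin 3 → Fin 3) × (Fin 3 → ℝ) × (Fin 3 → ℝ) =>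
        r (p.1 z) (p.2.1 (p.1 z))) :=
      measurable_apply_random_index
        (D := fun p : (Fin 3 → Fin 3) × (Fin 3 → ℝ) × (Fin 3 → ℝ) => p.1 z)
        (Y := fun t p => r t (p.2.1 t)) (by fun_prop) fun t => (hrmeas t).comp (by fun_prop)
    refine integral_eq_zero_of_setIntegral_level_eq_zero hZmeas (hRint z).aestronglyMeasurable
      (hindep.comp measurable_id hφ) (hZpos z) ((setIntegral_congr_fun
        (hZmeas (measurableSet_singleton z)) fun ω hω => ?_).trans (hmom z))
    have hω : Z ω = z := hω
    simp only [hr, hω]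
  have hresp : ∀ᵐ ω ∂P, (T 1 ω = T 0 ω ∨ T 1 ω = 1) ∧ (T 2 ω = T 0 ω ∨ T 2 ω = 2) := by
    filter_upwards [hmax] with ω hω
    refine ⟨maximizer_eq_or_eq_of_targeted (o := 0) (hω 0) (hω 1) hΔ11.le fun t ht => ?_,
      maximizer_eq_or_eq_of_targeted (o := 0) (hω 0) (hω 2) hΔ22.le fun t ht => ?_⟩
    · fin_cases t <;> simp_all
    · fin_cases t <;> simp_all
  have hD : ∀ t, Integrable (fun ω => Y t ω - Y 0 ω) P := fun t => (hYint t).sub (hYint 0)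
  have hfin : ∀ t : Fin 3, t = 0 ∨ t = 1 ∨ t = 2 := by decide
  have hG := measurableSet_grp3 hTmeas
  constructor
  · refine prr_mul_sub_eq_of_integral_eq (hRint 1) (hRint 0) (hD 1) (hD 2)
      (((hG _ _ _).union (hG _ _ _)).union (hG _ _ _)) (hG _ _ _)
      ((hzero 1).trans (hzero 0).symm) ?_
    filter_upwards [hresp] with ω hω
    simp only [hr, Set.indicator_apply, Set.mem_union, grp3, Set.mem_ofPred_eq]
    rcases hfin (T 0 ω) with h₀ | h₀ | h₀ <;> rcases hfin (T 1 ω) with h₁ | h₁ | h₁ <;>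
      rcases hfin (T 2 ω) with h₂ | h₂ | h₂ <;> simp [h₀, h₁, h₂] at hω ⊢ <;> ring
  · rw [neg_mul, neg_add_eq_sub]
    refine prr_mul_sub_eq_of_integral_eq (hRint 2) (hRint 0) (hD 2) (hD 1)
      (((hG _ _ _).union (hG _ _ _)).union (hG _ _ _)) (hG _ _ _)
      ((hzero 2).trans (hzero 0).symm) ?_
    filter_upwards [hresp] with ω hω
    simp only [hr, Set.indicator_apply, Set.mem_union, grp3, Set.mem_ofPred_eq]
    rcases hfin (T 0 ω) with h₀ | h₀ | h₀ <;> rcases hfin (T 1 ω) with h₁ | h₁ | h₁ <;>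
      rcases hfin (T 2 ω) with h₂ | h₂ | h₂ <;> simp [h₀, h₁, h₂] at hω ⊢ <;> ring
end
end
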